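/- arXiv:2310.11704 — 2 statements merged into one kernel-verified Lean document; each statement's English description precedes it below -/
import Mathlib

section
/- Let m ≥ 5 be an integer and let G be the graph obtained from the path P_m = u₁u₂⋯u_m by adding the two edges u₁u₃ and u₃u₅ (so G consists of two triangles u₁u₂u₃ and u₃u₄u₅ sharing the vertex u₃, together with the path u₅u₆⋯u_m attached at u₅). Then for every connected simple graph H of order n, p(G □ H) ≤ mn/2. -/
open SimpleGraph

/-- `P` is a path decomposition of `G`: a list of edge-disjoint paths of `G`
covering all the edges of `G`. -/
def SimpleGraph.IsPathDecomp {V : Type*} (G : SimpleGraph V)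
    (P : List (Σ u v : V, G.Walk u v)) : Prop :=
  (∀ p ∈ P, p.2.2.IsPath) ∧
  P.Pairwise (fun p q => ∀ e ∈ p.2.2.edges, e ∉ q.2.2.edges) ∧
  ∀ e ∈ G.edgeSet, ∃ p ∈ P, e ∈ p.2.2.edges

/-- `p(G)`: the minimum number of paths in a path decomposition of `G`. -/
noncomputable def SimpleGraph.pathNumber {V : Type*} (G : SimpleGraph V) : ℕ :=
  sInf {k | ∃ P, G.IsPathDecomp P ∧ P.length = k}

section Routes

variable {V V' : Type*}

/-- The multiset of edges traversed by a list of vertices. -/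
def pathEdges : List V → Multiset (Sym2 V)
  | [] => 0
  | [_] => 0
  | a :: b :: l => {s(a, b)} + pathEdges (b :: l)

/-- The two ends of a list of vertices (a one-element list has its vertex as both ends). -/
def pathEnds (l : List V) : Multiset V := (l.head?.toList ++ l.getLast?.toList : List V)

@[simp] theorem pathEdges_nil : pathEdges ([] : List V) = 0 := rfl

@[simp] theorem pathEdges_singleton (a : V) : pathEdges [a] = 0 := rfl

@[simp] theorem pathEdges_cons_cons (a b : V) (l : List V) :
    pathEdges (a :: b :: l) = {s(a, b)} + pathEdges (b :: l) := rfl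

theorem pathEdges_cons {a b : V} {l : List V} (h : l.head? = some b) :
    pathEdges (a :: l) = {s(a, b)} + pathEdges l := by
  cases l with
  | nil => simp at h
  | cons c l => simp at h; subst h; rfl

theorem pathEdges_append {a b : V} {A B : List V} (ha : A.getLast? = some a)
    (hb : B.head? = some b) : pathEdges (A ++ B) = pathEdges A + {s(a, b)} + pathEdges B := by
  induction A with
  | nil => simp at ha
  | cons c A ih =>
    cases A with
    | nil =>
      simp at ha
      subst ha
      simpa using pathEdges_cons hb
    | cons d A =>
      have := ih (by simpa using ha)
      simp only [List.cons_append, pathEdges_cons_cons] at this ⊢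
      rw [this]
      abel

@[simp] theorem pathEdges_reverse (l : List V) : pathEdges l.reverse = pathEdges l := by
  induction l with
  | nil => rfl
  | cons a l ih =>
    cases l with
    | nil => rfl
    | cons b l =>
      rw [List.reverse_cons, pathEdges_append (a := b) (b := a) (by simp) (by simp), ih,
        pathEdges_cons_cons, Sym2.eq_swap]
      simp [add_comm]

@[simp] theorem pathEdges_map (f : V → V') (l : List V) :
    pathEdges (l.map f) = (pathEdges l).map (Sym2.map f) := by
  induction l with
  | nil => rfl
  | cons a l ih =>
    cases l with
    | nil => rfl
    | cons b l => simpa using ih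

theorem exists_mem_pathEdges {l : List V} (hl : 2 ≤ l.length) {v : V} (hv : v ∈ l) :
    ∃ e ∈ pathEdges l, v ∈ e := by
  induction l with
  | nil => simp at hv
  | cons a l ih =>
    match l, hl, hv, ih with
    | [b], _, hv, _ => exact ⟨s(a, b), by simp, by simpa using hv⟩
    | b :: c :: l, _, hv, ih =>
      rcases List.mem_cons.1 hv with rfl | hv
      · exact ⟨s(v, b), by simp, by simp⟩
      · obtain ⟨e, he, hve⟩ := ih (by simp) hv
        exact ⟨e, by rw [pathEdges_cons_cons]; exact Multiset.mem_add.2 (.inr he), hve⟩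

@[simp] theorem pathEnds_reverse (l : List V) : pathEnds l.reverse = pathEnds l := by
  simp only [pathEnds, List.head?_reverse, List.getLast?_reverse, ← Multiset.coe_add]
  exact add_comm _ _

theorem pathEnds_append {A B : List V} (hA : A ≠ []) (hB : B ≠ []) :
    pathEnds (A ++ B) = (A.head?.toList : Multiset V) + (B.getLast?.toList : Multiset V) := by
  obtain ⟨a, A, rfl⟩ := List.exists_cons_of_ne_nil hA
  rw [pathEnds, List.getLast?_append_of_ne_nil _ hB]
  simp

theorem mem_sum_map {α β : Type*} {L : Multiset α} {f : α → Multiset β} {b : β} :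
    b ∈ (L.map f).sum ↔ ∃ a ∈ L, b ∈ f a :=
  Multiset.mem_bind (s := L) (f := f)

/-- A vertex list `q`, up to reversal, starts at `w` and, if it visits `y`, arrives there from a
vertex of `Z`. -/
def ReachesThrough (y : V) (Z : Set V) (w : V) (q : List V) : Prop :=
  ∃ q', (q' = q ∨ q' = q.reverse) ∧ q'.head? = some w ∧
    (y ∉ q' ∨ ∃ A z B, q' = A ++ z :: y :: B ∧ z ∈ Z)

theorem mem_edges_of_append (A B : List V) (z y : V) :
    s(z, y) ∈ pathEdges (A ++ z :: y :: B) := by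
  have : A ++ z :: y :: B = (A ++ [z]) ++ y :: B := by simp
  rw [this, pathEdges_append (a := z) (b := y) (by simp) (by simp)]
  simp

theorem exists_extension_aux [DecidableEq V] (y : V) (Z : Finset V)
    (z : V) (hzy : z ≠ y) (L : Multiset (List V)) (hL : ∀ p ∈ L, p ≠ [] ∧ p.Nodup)
    (hE : ({s(z, y)} + (L.map pathEdges).sum).Nodup)
    (hZ : ∀ w ∈ Z, w ≠ y ∧ s(w, y) ∈ (L.map pathEdges).sum)
    (hgood : ∀ w ∈ insert z Z, ∃ q ∈ L, ReachesThrough y Z w q) :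
    ∃ L' : Multiset (List V), (∀ p ∈ L', p ≠ [] ∧ p.Nodup) ∧
      (L'.map pathEdges).sum = {s(z, y)} + (L.map pathEdges).sum ∧
      (L'.map pathEnds).sum + {z} = (L.map pathEnds).sum + {y} := by
  induction hn : Z.card using Nat.strong_induction_on generalizing Z z L with
  | _ n ih =>
  subst hn
  obtain ⟨q, hq, q', hqq', hhead, hreach⟩ := hgood z (Finset.mem_insert_self _ _)
  obtain ⟨L, rfl⟩ := Multiset.exists_cons_of_mem hq
  have hedges : pathEdges q = pathEdges q' := by rcases hqq' with rfl | rfl <;> simp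
  have hends : pathEnds q = pathEnds q' := by rcases hqq' with rfl | rfl <;> simp
  have hnd : q'.Nodup := by
    rcases hqq' with rfl | rfl
    · exact (hL _ hq).2
    · exact List.nodup_reverse.2 (hL _ hq).2
  have hL1 : ∀ p ∈ L, p ≠ [] ∧ p.Nodup := fun p hp => hL p (Multiset.mem_cons_of_mem hp)
  simp only [Multiset.map_cons, Multiset.sum_cons, hedges, hends] at hE hZ ⊢
  have hzZ : z ∉ Z := fun h => by
    have := (hZ z h).2
    exact Multiset.disjoint_left.1 (Multiset.nodup_add.1 hE).2.2
      (Multiset.mem_singleton_self _) this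
  rcases hreach with hy | ⟨A, z', B, rfl, hz'⟩
  · refine ⟨(y :: q') ::ₘ L, ?_, ?_, ?_⟩
    · intro p hp
      rcases Multiset.mem_cons.1 hp with rfl | hp
      · exact ⟨by simp, List.nodup_cons.2 ⟨hy, hnd⟩⟩
      · exact hL1 p hp
    · rw [Multiset.map_cons, Multiset.sum_cons, pathEdges_cons hhead, Sym2.eq_swap, add_assoc]
    · have hne : q' ≠ [] := by rintro rfl; simp at hhead
      have h1 : pathEnds (y :: q') = {y} + (q'.getLast?.toList : Multiset V) := by
        have := pathEnds_append (A := [y]) (B := q') (by simp) hne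
        simpa using this
      have h2 : pathEnds q' = {z} + (q'.getLast?.toList : Multiset V) := by
        rw [pathEnds, hhead, ← Multiset.coe_add]; rfl
      rw [Multiset.map_cons, Multiset.sum_cons, h1, h2]
      abel
  · have hsplit : A ++ z' :: y :: B = (A ++ [z']) ++ y :: B := by simp
    have hChead : (A ++ [z']).head? = some z := by
      rw [hsplit, List.head?_append_of_ne_nil _ (by simp)] at hhead; exact hhead
    have hClast : (A ++ [z']).reverse.getLast? = some z := by rw [List.getLast?_reverse, hChead]
    have hz'y : z' ≠ y := (hZ z' hz').1
    have eq : pathEdges (A ++ z' :: y :: B)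
        = pathEdges (A ++ [z']) + {s(z', y)} + pathEdges (y :: B) := by
      rw [hsplit, pathEdges_append (a := z') (b := y) (by simp) (by simp)]
    have ep : pathEdges ((A ++ [z']).reverse ++ y :: B)
        = pathEdges (A ++ [z']) + {s(z, y)} + pathEdges (y :: B) := by
      rw [pathEdges_append (a := z) (b := y) hClast (by simp), pathEdges_reverse]
    have nq : pathEnds (A ++ z' :: y :: B) = {z} + ((y :: B).getLast?.toList : Multiset V) := by
      rw [hsplit, pathEnds_append (by simp) (by simp), hChead]; rfl
    have np : pathEnds ((A ++ [z']).reverse ++ y :: B)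
        = {z'} + ((y :: B).getLast?.toList : Multiset V) := by
      rw [pathEnds_append (by simp) (by simp)]; simp
    have hpnd : ((A ++ [z']).reverse ++ y :: B).Nodup := by
      rw [hsplit] at hnd
      refine (List.Perm.nodup_iff ?_).1 hnd
      exact List.Perm.append_right _ (List.reverse_perm _).symm
    set p := (A ++ [z']).reverse ++ y :: B with hp
    have hsum : {s(z', y)} + (pathEdges p + (L.map pathEdges).sum)
        = {s(z, y)} + (pathEdges (A ++ z' :: y :: B) + (L.map pathEdges).sum) := by
      rw [ep, eq]; abel
    have key := ih (Z.erase z').card (Finset.card_erase_lt_of_mem hz') (Z.erase z') z' hz'y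
      (p ::ₘ L) ?_ ?_ ?_ ?_ rfl
    · obtain ⟨L', h1, h2, h3⟩ := key
      refine ⟨L', h1, ?_, ?_⟩
      · rw [h2, Multiset.map_cons, Multiset.sum_cons, hsum]
      · rw [Multiset.map_cons, Multiset.sum_cons, np] at h3
        rw [nq]
        refine add_right_cancel (b := {z'}) ?_
        rw [add_right_comm, h3]
        abel
    · intro r hr
      rcases Multiset.mem_cons.1 hr with rfl | hr
      · exact ⟨by simp [hp], hpnd⟩
      · exact hL1 r hr
    · rw [Multiset.map_cons, Multiset.sum_cons, hsum]; exact hE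
    · intro w hw
      have hw' := Finset.mem_erase.1 hw
      refine ⟨(hZ w hw'.2).1, ?_⟩
      have h1 : s(w, y) ∈ {s(z', y)} + (pathEdges p + (L.map pathEdges).sum) := by
        rw [hsum]; exact Multiset.mem_add.2 (.inr (hZ w hw'.2).2)
      rw [Multiset.map_cons, Multiset.sum_cons]
      rcases Multiset.mem_add.1 h1 with h | h
      · simp only [Multiset.mem_singleton, Sym2.congr_left] at h
        exact absurd h hw'.1
      · exact h
    · rw [Finset.insert_erase hz']
      intro w hw
      obtain ⟨r, hr, r', hrr', hrhead, hrreach⟩ := hgood w (Finset.mem_insert_of_mem hw)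
      rcases Multiset.mem_cons.1 hr with rfl | hr
      · have hq'r : r' = A ++ z' :: y :: B ∨ r' = (A ++ z' :: y :: B).reverse := by
          rcases hqq' with h | h <;> rcases hrr' with h' | h' <;> simp [h, h']
        rcases hq'r with rfl | rfl
        · rw [hhead] at hrhead
          simp only [Option.some.injEq] at hrhead
          exact absurd (hrhead ▸ hw) hzZ
        · refine ⟨p, Multiset.mem_cons_self _ _, p.reverse, .inr rfl, ?_, .inr ?_⟩
          · rw [hp, List.head?_reverse, List.getLast?_append_of_ne_nil _ (by simp)]
            rw [hsplit, List.head?_reverse, List.getLast?_append_of_ne_nil _ (by simp)] at hrhead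
            exact hrhead
          · rcases hrreach with h | ⟨A2, z2, B2, h, hz2⟩
            · simp at h
            · have hB : B.reverse ++ y :: (A ++ [z']).reverse = (A2 ++ [z2]) ++ y :: B2 := by
                simpa using h
              have hnd2 : (B.reverse ++ y :: (A ++ [z']).reverse).Nodup := by
                have := List.nodup_reverse.2 hnd
                simpa using this
              have hBA : B.reverse = A2 ++ [z2] := by
                have h1 : y ∉ B.reverse := fun hy =>
                  (List.nodup_append.1 hnd2).2.2 y hy y (by simp) rfl
                have h2 : y ∉ A2 ++ [z2] := fun hy =>
                  (List.nodup_append.1 (hB ▸ hnd2)).2.2 y hy y (by simp) rfl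
                have := congrArg (List.takeWhile (· ≠ y)) hB
                rwa [List.takeWhile_append_of_pos, List.takeWhile_append_of_pos,
                  List.takeWhile_cons_of_neg, List.takeWhile_cons_of_neg, List.append_nil,
                  List.append_nil] at this
                · simp
                · simp
                · exact fun a ha => decide_eq_true fun e => h2 (e ▸ ha)
                · exact fun a ha => decide_eq_true fun e => h1 (e ▸ ha)
              refine ⟨A2, z2, A ++ [z'], ?_, ?_⟩
              · rw [hp]
                have : ((A ++ [z']).reverse ++ y :: B).reverse = B.reverse ++ y :: (A ++ [z']) := by
                  simp
                rw [this, hBA]; simp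
              · simp only [Finset.coe_erase, Set.mem_sdiff, Set.mem_singleton_iff]
                refine ⟨hz2, fun e => ?_⟩
                have h1 : z' ∈ B.reverse := by rw [hBA]; simp [e]
                exact (List.nodup_append.1 hnd2).2.2 z' h1 z' (by simp) rfl
      · refine ⟨r, Multiset.mem_cons_of_mem hr, r', hrr', hrhead, ?_⟩
        rcases hrreach with h | ⟨A2, z2, B2, h, hz2⟩
        · exact .inl h
        · refine .inr ⟨A2, z2, B2, h, ?_⟩
          simp only [Finset.coe_erase, Set.mem_sdiff, Set.mem_singleton_iff]
          refine ⟨hz2, fun e => ?_⟩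
          subst e
          have h1 : s(z2, y) ∈ pathEdges r := by
            have : pathEdges r = pathEdges r' := by rcases hrr' with rfl | rfl <;> simp
            rw [this, h]; exact mem_edges_of_append _ _ _ _
          have h2 : s(z2, y) ∈ (L.map pathEdges).sum := mem_sum_map.2 ⟨_, hr, h1⟩
          have h3 := (Multiset.nodup_add.1 (Multiset.nodup_add.1 hE).2.1).2.2
          exact Multiset.disjoint_left.1 h3 (mem_edges_of_append _ _ _ _) h2

/-- If every neighbour of `y` is an end of some path, then an edge `xy` can be added to a path
decomposition so that, of the ends, only one at `x` moves to `y`. -/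
theorem exists_extension [DecidableEq V] {x y : V} (hxy : x ≠ y) (L : Multiset (List V))
    (hL : ∀ p ∈ L, p ≠ [] ∧ p.Nodup)
    (hE : ({s(x, y)} + (L.map pathEdges).sum).Nodup)
    (hloop : s(y, y) ∉ (L.map pathEdges).sum)
    (hx : x ∈ (L.map pathEnds).sum)
    (hy : ∀ w, s(w, y) ∈ (L.map pathEdges).sum → w ∈ (L.map pathEnds).sum) :
    ∃ L' : Multiset (List V), (∀ p ∈ L', p ≠ [] ∧ p.Nodup) ∧
      (L'.map pathEdges).sum = {s(x, y)} + (L.map pathEdges).sum ∧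
      (L'.map pathEnds).sum + {x} = (L.map pathEnds).sum + {y} := by
  classical
  let N : Set V := {w | s(w, y) ∈ (L.map pathEdges).sum}
  have hN : N.Finite := by
    have : Set.Finite {e | e ∈ (L.map pathEdges).sum} := Multiset.finite_toSet _
    exact this.preimage (f := fun w => s(w, y)) (by intro a _ b _; simp; grind)
  refine exists_extension_aux y hN.toFinset x hxy L hL hE ?_ ?_
  · intro w hw
    have hw : s(w, y) ∈ (L.map pathEdges).sum := by simpa [N] using hw
    exact ⟨fun e => hloop (e ▸ hw), hw⟩
  · intro w hw
    have hw1 : w ∈ (L.map pathEnds).sum ∧ w ≠ y := by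
      rcases Finset.mem_insert.1 hw with rfl | hw
      · exact ⟨hx, hxy⟩
      · have hw : s(w, y) ∈ (L.map pathEdges).sum := by simpa [N] using hw
        exact ⟨hy w hw, fun e => hloop (e ▸ hw)⟩
    obtain ⟨q, hq, hmem⟩ := mem_sum_map.1 hw1.1
    refine ⟨q, hq, ?_⟩
    obtain ⟨q', hqq', hhead⟩ : ∃ q', (q' = q ∨ q' = q.reverse) ∧ q'.head? = some w := by
      simp only [pathEnds, Multiset.mem_coe, List.mem_append, Option.mem_toList] at hmem
      rcases hmem with h | h
      · exact ⟨q, .inl rfl, by simpa using h⟩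
      · exact ⟨q.reverse, .inr rfl, by simpa using h⟩
    refine ⟨q', hqq', hhead, ?_⟩
    by_cases hyq : y ∈ q'
    · right
      obtain ⟨A, B, rfl⟩ := List.append_of_mem hyq
      have hA : A ≠ [] := by
        rintro rfl
        simp at hhead
        exact hw1.2 hhead.symm
      obtain ⟨A, z, rfl⟩ := (List.eq_nil_or_concat A).resolve_left hA
      refine ⟨A, z, B, by simp, ?_⟩
      simp only [Set.Finite.coe_toFinset]
      refine mem_sum_map.2 ⟨_, hq, ?_⟩
      have h1 : pathEdges q = pathEdges (A ++ z :: y :: B) := by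
        rcases hqq' with h | h
        · rw [← h]; simp
        · rw [← pathEdges_reverse q, ← h]; simp
      rw [h1]; exact mem_edges_of_append _ _ _ _
    · exact .inl hyq

/-- `E` can be decomposed into nonempty paths such that exactly `f v` path ends are at `v`, for
every `v`. -/
def HasPathsWithEnds [DecidableEq V] (E : Finset (Sym2 V)) (f : V → ℕ) : Prop :=
  ∃ L : Multiset (List V), (∀ p ∈ L, p ≠ [] ∧ p.Nodup) ∧
    (L.map pathEdges).sum = E.val ∧ ∀ v, (L.map pathEnds).sum.count v = f v

/-- The degree of a vertex in a set of edges. -/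
def edgeDegree [DecidableEq V] (E : Finset (Sym2 V)) (v : V) : ℕ := (E.filter (v ∈ ·)).card

theorem edgeDegree_insert [DecidableEq V] {E : Finset (Sym2 V)} {x y : V} (h : s(x, y) ∉ E)
    (v : V) :
    edgeDegree (insert s(x, y) E) v = edgeDegree E v + if v = x ∨ v = y then 1 else 0 := by
  unfold edgeDegree
  rw [Finset.filter_insert]
  by_cases hv : v = x ∨ v = y
  · rw [if_pos (by simpa using hv), Finset.card_insert_of_notMem (by simp [h]), if_pos hv]
  · rw [if_neg (by simpa using hv), if_neg hv, add_zero]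

theorem HasPathsWithEnds.extend [DecidableEq V] {E : Finset (Sym2 V)} {f g : V → ℕ} {x y : V}
    (h : HasPathsWithEnds E f) (hxy : x ≠ y) (he : s(x, y) ∉ E) (hloop : s(y, y) ∉ E)
    (hx : 1 ≤ f x) (hy : ∀ w, s(w, y) ∈ E → 1 ≤ f w)
    (hg : ∀ v, g v + (if v = x then 1 else 0) = f v + if v = y then 1 else 0) :
    HasPathsWithEnds (insert s(x, y) E) g := by
  obtain ⟨L, hL, hE, hf⟩ := h
  obtain ⟨L', h1, h2, h3⟩ := exists_extension hxy L hL
    (by rw [hE, Multiset.singleton_add]; exact Multiset.nodup_cons.2 ⟨he, E.nodup⟩)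
    (by rw [hE]; exact hloop)
    (by rw [← Multiset.one_le_count_iff_mem, hf]; exact hx)
    (by
      intro w hw
      rw [← Multiset.one_le_count_iff_mem, hf]
      rw [hE] at hw
      exact hy w hw)
  refine ⟨L', h1, ?_, fun v => ?_⟩
  · rw [h2, hE, Finset.insert_val_of_notMem he, Multiset.singleton_add]
  · have := congrArg (Multiset.count v) h3
    simp only [Multiset.count_add, Multiset.count_singleton, hf] at this
    have := hg v
    omega

theorem HasPathsWithEnds.insert_edge [DecidableEq V] {E : Finset (Sym2 V)} {f g : V → ℕ} {x y : V}
    (h : HasPathsWithEnds E f) (hxy : x ≠ y) (he : s(x, y) ∉ E)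
    (hg : ∀ v, g v = f v + (if v = x then 1 else 0) + if v = y then 1 else 0) :
    HasPathsWithEnds (insert s(x, y) E) g := by
  obtain ⟨L, hL, hE, hf⟩ := h
  refine ⟨[x, y] ::ₘ L, ?_, ?_, fun v => ?_⟩
  · intro p hp
    rcases Multiset.mem_cons.1 hp with rfl | hp
    · simp [hxy]
    · exact hL p hp
  · rw [Multiset.map_cons, Multiset.sum_cons, hE, Finset.insert_val_of_notMem he]
    simp
  · rw [Multiset.map_cons, Multiset.sum_cons, Multiset.count_add, hf, hg]
    have : pathEnds [x, y] = {x} + {y} := rfl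
    simp only [this, Multiset.count_add, Multiset.count_singleton]
    omega

theorem HasPathsWithEnds.remove_isolated [DecidableEq V] {E : Finset (Sym2 V)} {f g : V → ℕ} {z : V}
    (h : HasPathsWithEnds E f) (hz : edgeDegree E z = 0) (hfz : f z = 2)
    (hg : ∀ v, g v = if v = z then 0 else f v) : HasPathsWithEnds E g := by
  obtain ⟨L, hL, hE, hf⟩ := h
  have hmem : z ∈ (L.map pathEnds).sum := by
    rw [← Multiset.one_le_count_iff_mem, hf, hfz]; norm_num
  obtain ⟨p, hp, hzp⟩ := mem_sum_map.1 hmem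
  have hzp : z ∈ p := by
    simp only [pathEnds, Multiset.mem_coe, List.mem_append, Option.mem_toList] at hzp
    rcases hzp with h | h
    · exact List.mem_of_head? h
    · exact List.mem_of_getLast? h
  have hpz : p = [z] := by
    by_contra hne
    have hlen : 2 ≤ p.length := by
      match p, hzp, hne with
      | [a], h, hne => simp at h; simp [h] at hne
      | a :: b :: l, _, _ => simp
    obtain ⟨e, he, hze⟩ := exists_mem_pathEdges hlen hzp
    have : e ∈ E := by
      rw [← Finset.mem_val, ← hE]; exact mem_sum_map.2 ⟨p, hp, he⟩
    rw [edgeDegree, Finset.card_eq_zero] at hz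
    exact Finset.notMem_empty e (hz ▸ Finset.mem_filter.2 ⟨this, hze⟩)
  subst hpz
  obtain ⟨L, rfl⟩ := Multiset.exists_cons_of_mem hp
  refine ⟨L, fun p hp => hL p (Multiset.mem_cons_of_mem hp), ?_, fun v => ?_⟩
  · simpa using hE
  · have h1 := hf v
    have : pathEnds [z] = {z} + {z} := rfl
    simp only [Multiset.map_cons, Multiset.sum_cons, this, Multiset.count_add,
      Multiset.count_singleton] at h1
    rw [hg]
    split_ifs at h1 ⊢ with hvz
    · subst hvz; omega
    · omega

/-- **Lovász's path decomposition theorem**, with control of the ends: every finite set of edges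
decomposes into paths such that each odd vertex is the end of one path and each even vertex is
twice the end of a path, except that one prescribed even vertex may be required to be the end of
no path. -/
theorem hasPathsWithEnds [Fintype V] [DecidableEq V] (E : Finset (Sym2 V))
    (hE : ∀ e ∈ E, ¬ e.IsDiag) (o : Option V) (ho : ∀ z ∈ o, Even (edgeDegree E z)) :
    HasPathsWithEnds E
      (fun v => if o = some v then 0 else if Even (edgeDegree E v) then 2 else 1) := by
  induction hn : E.card using Nat.strong_induction_on generalizing E o with
  | _ n ih =>
  subst hn
  have hstep : ∀ e ∈ E, ∃ x y E', e = s(x, y) ∧ x ≠ y ∧ s(x, y) ∉ E' ∧ E = insert s(x, y) E' ∧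
      (∀ v, s(v, v) ∉ E') ∧ ∀ o : Option V, (∀ z ∈ o, Even (edgeDegree E' z)) →
        HasPathsWithEnds E'
          (fun v => if o = some v then 0 else if Even (edgeDegree E' v) then 2 else 1) := by
    intro e he
    induction e with | _ x y
    refine ⟨x, y, E.erase s(x, y), rfl, fun h => hE _ he (by simpa using h),
      Finset.notMem_erase _ _, (Finset.insert_erase he).symm,
      fun v hv => hE _ (Finset.mem_of_mem_erase hv) (by simp), fun o ho => ?_⟩
    exact ih _ (Finset.card_erase_lt_of_mem he) _
      (fun e he => hE e (Finset.mem_of_mem_erase he)) o ho rfl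
  have hnone : HasPathsWithEnds E (fun v => if Even (edgeDegree E v) then 2 else 1) := by
    rcases E.eq_empty_or_nonempty with rfl | ⟨e, he⟩
    · refine ⟨Finset.univ.val.map fun v => [v], by simp, by simp, fun v => ?_⟩
      simp only [edgeDegree, pathEnds, Multiset.map_map, Function.comp_def, Finset.filter_empty,
        Finset.card_empty, Even.zero, if_true]
      rw [← Finset.sum_eq_multiset_sum, Multiset.count_sum', Finset.sum_eq_single v] <;>
        simp +contextual
    · obtain ⟨x, y, E', -, hxy, hnot, rfl, hdiag, ih'⟩ := hstep e he
      have hdeg := edgeDegree_insert hnot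
      have hdx := hdeg x
      have hdy := hdeg y
      simp only [true_or, or_true, if_true] at hdx hdy
      have hoth : ∀ v, v ≠ x → v ≠ y → edgeDegree (insert s(x, y) E') v = edgeDegree E' v := by
        intro v h1 h2
        simp [hdeg, h1, h2]
      have hswap : insert s(x, y) E' = insert s(y, x) E' := by rw [Sym2.eq_swap]
      have hnot' : s(y, x) ∉ E' := by rwa [Sym2.eq_swap]
      by_cases hx : Even (edgeDegree E' x) <;> by_cases hy : Even (edgeDegree E' y)
      · have h := (ih' (some x) (by simpa using hx)).extend (x := y) (y := x)
          (g := fun v => if Even (edgeDegree (insert s(x, y) E') v) then 2 else 1)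
          hxy.symm hnot' (hdiag _) (by simp [hxy]; grind) (by grind)
          (by intro v; grind)
        rwa [← hswap] at h
      · exact (ih' none (by simp)).extend hxy hnot (hdiag _) (by grind) (by grind)
          (by intro v; grind)
      · have h := (ih' none (by simp)).extend (x := y) (y := x)
          (g := fun v => if Even (edgeDegree (insert s(x, y) E') v) then 2 else 1)
          hxy.symm hnot' (hdiag _) (by grind) (by grind) (by intro v; grind)
        rwa [← hswap] at h
      · exact (ih' none (by simp)).insert_edge hxy hnot (by intro v; grind)
  match o with
  | none => simpa using hnone
  | some z =>
    have hz := ho z rfl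
    by_cases hz0 : edgeDegree E z = 0
    · exact hnone.remove_isolated hz0 (by simp [hz0]) (by intro v; grind)
    · obtain ⟨e, he⟩ := Finset.card_pos.1 (Nat.pos_of_ne_zero hz0)
      obtain ⟨heE, hze⟩ := Finset.mem_filter.1 he
      obtain ⟨y, rfl⟩ := Sym2.mem_iff_exists.1 hze
      obtain ⟨x', y', E', hxy', hne, hnot, hins, hdiag, ih'⟩ := hstep _ heE
      rw [← hxy'] at hnot hins
      have hzy : z ≠ y := fun h => hE _ heE (by simpa using h)
      subst hins
      have hdeg := edgeDegree_insert hnot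
      have hdz := hdeg z
      have hdy := hdeg y
      simp only [true_or, or_true, if_true] at hdz hdy
      have hoth : ∀ v, v ≠ z → v ≠ y → edgeDegree (insert s(z, y) E') v = edgeDegree E' v := by
        intro v h1 h2
        simp [hdeg, h1, h2]
      by_cases hy : Even (edgeDegree E' y)
      · exact (ih' (some y) (by simpa using hy)).extend hzy hnot (hdiag _) (by grind)
          (by grind) (by intro v; grind)
      · exact (ih' none (by simp)).extend hzy hnot (hdiag _) (by grind) (by grind)
          (by intro v; grind)

theorem pathEdges_reverse_append_cons (A B : List V) (x : V) :
    pathEdges (A.reverse ++ x :: B) = pathEdges (x :: A) + pathEdges (x :: B) := by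
  cases A with
  | nil => simp
  | cons a A =>
    rw [pathEdges_append (a := a) (b := x) (by simp) (by simp), pathEdges_reverse,
      pathEdges_cons_cons, Sym2.eq_swap]
    abel

/-- `(a, b, p)` is a path `p` from `a` to `b`. -/
def IsPathTriple (t : V × V × List V) : Prop :=
  t.2.2.head? = some t.1 ∧ t.2.2.getLast? = some t.2.1 ∧ t.2.2.Nodup

theorem exists_map_some {l : List (Option V)} (h : none ∉ l) : ∃ l' : List V, l = l'.map some := by
  induction l with
  | nil => exact ⟨[], rfl⟩
  | cons a l ih =>
    obtain ⟨l', rfl⟩ := ih fun h' => h (List.mem_cons_of_mem _ h')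
    cases a with
    | none => simp at h
    | some a => exact ⟨a :: l', rfl⟩

theorem exists_arm_triple (A : List V) (hA : A.Nodup) :
    ∃ X : Multiset (V × V × List V), (∀ t ∈ X, IsPathTriple t) ∧
      pathEdges (none :: A.map some) = ((X.map fun t => pathEdges t.2.2).sum).map (Sym2.map some) +
        (X.map fun t => t.2.1).map (fun v => s(none, some v)) ∧
      X.map (fun t => t.1) = A.getLast?.toList := by
  rcases List.eq_nil_or_concat' A with rfl | ⟨A, b, rfl⟩
  · exact ⟨0, by simp, by simp, by simp⟩
  · obtain ⟨a, A', hA'⟩ := List.exists_cons_of_ne_nil (l := A ++ [b]) (by simp)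
    refine ⟨{(b, a, (A ++ [b]).reverse)}, ?_, ?_, ?_⟩
    · intro t ht
      rw [Multiset.mem_singleton.1 ht]
      refine ⟨by simp, ?_, List.nodup_reverse.2 hA⟩
      rw [List.getLast?_reverse, hA']; rfl
    · simp only [Multiset.map_singleton, Multiset.sum_singleton, pathEdges_reverse]
      rw [hA']
      rw [pathEdges_cons (b := some a) (by simp), pathEdges_map, add_comm]
    · simp

theorem exists_triples_of_list [DecidableEq V] (p : List (Option V)) (hne : p ≠ [])
    (hp : p.Nodup) :
    ∃ N X : Multiset (V × V × List V), (∀ t ∈ N, IsPathTriple t) ∧ (∀ t ∈ X, IsPathTriple t) ∧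
      pathEdges p = ((N.map fun t => pathEdges t.2.2).sum +
        (X.map fun t => pathEdges t.2.2).sum).map (Sym2.map some) +
        (X.map fun t => t.2.1).map (fun v => s(none, some v)) ∧
      ∀ w, (pathEnds p).count (some w) =
        ((N.map fun t => ({t.1} + {t.2.1} : Multiset V)).sum + X.map fun t => t.1).count w := by
  by_cases hn : none ∈ p
  · obtain ⟨A, B, rfl⟩ := List.append_of_mem hn
    have hnd := List.nodup_append.1 hp
    obtain ⟨A, rfl⟩ := exists_map_some (l := A) fun h => hnd.2.2 _ h none (by simp) rfl
    obtain ⟨B, rfl⟩ := exists_map_some (l := B) (List.nodup_cons.1 hnd.2.1).1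
    obtain ⟨X1, h1, h2, h3⟩ := exists_arm_triple A.reverse
      (List.nodup_reverse.2 (List.Nodup.of_map _ hnd.1))
    obtain ⟨X2, h1', h2', h3'⟩ := exists_arm_triple B
      (List.Nodup.of_map _ (List.nodup_cons.1 hnd.2.1).2)
    refine ⟨0, X1 + X2, by simp, ?_, ?_, ?_⟩
    · intro t ht
      rcases Multiset.mem_add.1 ht with h | h
      · exact h1 t h
      · exact h1' t h
    · have := pathEdges_reverse_append_cons (A.reverse.map some) (B.map some) none
      rw [h2, h2', List.map_reverse, List.reverse_reverse] at this
      rw [this]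
      simp only [Multiset.map_add, Multiset.sum_add, Multiset.map_zero, Multiset.sum_zero, zero_add]
      abel
    · intro w
      have key : ∀ (A : List V) (C : List (Option V)),
          Multiset.count (some w) ((A.map some ++ none :: C).head?.toList : Multiset (Option V)) =
            Multiset.count w (A.head?.toList : Multiset V) := by
        intro A C
        cases A <;> simp [Multiset.count_singleton]
      have h5 := key A (B.map some)
      have h6 := key B.reverse (A.map some).reverse
      rw [List.head?_reverse, List.map_reverse, show (B.map some).reverse ++ none ::
        (A.map some).reverse = (A.map some ++ none :: B.map some).reverse by simp,
        List.head?_reverse] at h6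
      rw [Multiset.map_add, h3, h3', pathEnds, List.getLast?_reverse, ← Multiset.coe_add,
        Multiset.count_add, h5, h6]
      simp
  · obtain ⟨p, rfl⟩ := exists_map_some hn
    obtain ⟨a, p', hp'⟩ := List.exists_cons_of_ne_nil (l := p) (by simpa using hne)
    obtain ⟨q, b, hb⟩ := (List.eq_nil_or_concat' p).resolve_left (by simpa using hne)
    refine ⟨{(a, b, p)}, 0, ?_, by simp, ?_, ?_⟩
    · intro t ht
      rw [Multiset.mem_singleton.1 ht]
      exact ⟨by simp [hp'], by simp [hb], List.Nodup.of_map _ hp⟩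
    · simp
    · intro w
      have : pathEnds (p.map some) = {some a} + {some b} := by
        have h1 : p.head? = some a := by simp [hp']
        have h2 : p.getLast? = some b := by simp [hb]
        simp [pathEnds, h1, h2]; rfl
      rw [this]
      simp [Multiset.count_singleton, -Multiset.singleton_add]

theorem exists_triples_of_multiset [DecidableEq V] (L : Multiset (List (Option V)))
    (hL : ∀ p ∈ L, p ≠ [] ∧ p.Nodup) :
    ∃ N X : Multiset (V × V × List V), (∀ t ∈ N, IsPathTriple t) ∧ (∀ t ∈ X, IsPathTriple t) ∧
      (L.map pathEdges).sum = ((N.map fun t => pathEdges t.2.2).sum +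
        (X.map fun t => pathEdges t.2.2).sum).map (Sym2.map some) +
        (X.map fun t => t.2.1).map (fun v => s(none, some v)) ∧
      ∀ w, (L.map pathEnds).sum.count (some w) =
        ((N.map fun t => ({t.1} + {t.2.1} : Multiset V)).sum + X.map fun t => t.1).count w := by
  induction L using Multiset.induction_on with
  | empty => exact ⟨0, 0, by simp⟩
  | cons p L ih =>
    obtain ⟨N, X, h1, h2, h3, h4⟩ := ih fun q hq => hL q (Multiset.mem_cons_of_mem hq)
    have hp := hL p (Multiset.mem_cons_self _ _)
    obtain ⟨N', X', h1', h2', h3', h4'⟩ := exists_triples_of_list p hp.1 hp.2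
    refine ⟨N' + N, X' + X, ?_, ?_, ?_, ?_⟩
    · intro t ht
      exact (Multiset.mem_add.1 ht).elim (h1' t) (h1 t)
    · intro t ht
      exact (Multiset.mem_add.1 ht).elim (h2' t) (h2 t)
    · rw [Multiset.map_cons, Multiset.sum_cons, h3, h3']
      simp only [Multiset.map_add, Multiset.sum_add]
      abel
    · intro w
      rw [Multiset.map_cons, Multiset.sum_cons, Multiset.count_add, h4, h4']
      simp only [Multiset.map_add, Multiset.sum_add, Multiset.count_add]
      omega

/-- Every graph decomposes into paths so that each vertex is the main end of exactly one path; the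
paths in `N` have two main ends, and those in `X` run from a main end to a further end, where the
further ends are exactly the even vertices. -/
theorem exists_mainEnd_decomposition [Fintype V] [DecidableEq V] (E : Finset (Sym2 V))
    (hE : ∀ e ∈ E, ¬ e.IsDiag) :
    ∃ N X : Multiset (V × V × List V),
      (∀ t ∈ N, IsPathTriple t ∧ t.1 ≠ t.2.1) ∧ (∀ t ∈ X, IsPathTriple t) ∧
      (N.map fun t => pathEdges t.2.2).sum + (X.map fun t => pathEdges t.2.2).sum = E.val ∧
      (N.map fun t => ({t.1} + {t.2.1} : Multiset V)).sum + X.map (fun t => t.1) =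
        Finset.univ.val ∧
      X.map (fun t => t.2.1) = (Finset.univ.filter fun v => Even (edgeDegree E v)).val := by
  set S : Finset V := Finset.univ.filter fun v => Even (edgeDegree E v) with hS
  let c : V → Sym2 (Option V) := fun v => s(none, some v)
  have hc : Function.Injective c := fun a b h => by simpa [c] using h
  have hs : Function.Injective (Sym2.map (some : V → Option V)) :=
    Sym2.map.injective (Option.some_injective _)
  have hcs : ∀ e v, Sym2.map (some : V → Option V) e ≠ c v := by
    intro e v h
    induction e with | _ x y
    simp [c] at h
  set E' : Finset (Sym2 (Option V)) := E.map ⟨_, hs⟩ ∪ S.map ⟨_, hc⟩ with hE'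
  have hdisj : Disjoint (E.map ⟨_, hs⟩) (S.map ⟨_, hc⟩) := by
    rw [Finset.disjoint_left]
    intro e h1 h2
    obtain ⟨e1, -, rfl⟩ := Finset.mem_map.1 h1
    obtain ⟨v, -, h⟩ := Finset.mem_map.1 h2
    exact hcs _ _ h.symm
  have hval : E'.val = E.val.map (Sym2.map some) + S.val.map c := by
    rw [hE', ← Finset.disjUnion_eq_union _ _ hdisj]; rfl
  have hdeg : ∀ v, edgeDegree E' (some v) = edgeDegree E v + if v ∈ S then 1 else 0 := by
    intro v
    rw [hE', edgeDegree, Finset.filter_union, Finset.card_union_of_disjoint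
      (Finset.disjoint_filter_filter hdisj), Finset.filter_map, Finset.filter_map, Finset.card_map,
      Finset.card_map, edgeDegree]
    congr 1
    · congr 1
      ext e
      induction e with | _ x y
      simp
    · simp [c, Finset.filter_eq]
      split_ifs <;> rfl
  have hodd : ∀ v, ¬ Even (edgeDegree E' (some v)) := by
    intro v
    rw [hdeg]
    have : v ∈ S ↔ Even (edgeDegree E v) := by simp [hS]
    by_cases h : Even (edgeDegree E v)
    · simp [this, h, Nat.even_add_one]
    · simp [this, h]
  obtain ⟨L, hL, hLE, hLf⟩ := hasPathsWithEnds E' (by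
    intro e he
    rw [hE', Finset.mem_union, Finset.mem_map, Finset.mem_map] at he
    rcases he with ⟨e, he, rfl⟩ | ⟨v, -, rfl⟩
    · have := hE e he
      induction e with | _ x y
      simpa using this
    · simp [c]) (if Even (edgeDegree E' none) then some none else none) (by
    intro z hz
    split_ifs at hz with h
    · simp at hz; rwa [← hz]
    · simp at hz)
  obtain ⟨N, X, h1, h2, h3, h4⟩ := exists_triples_of_multiset L hL
  have hends : (N.map fun t => ({t.1} + {t.2.1} : Multiset V)).sum + X.map (fun t => t.1) =
        Finset.univ.val := by
    ext w
    rw [← h4, hLf, Multiset.count_eq_one_of_mem Finset.univ.nodup (Finset.mem_univ_val w)]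
    have := hodd w
    simp only
    rw [if_neg (by by_cases h : Even (edgeDegree E' none) <;> simp [h]), if_neg (hodd w)]
  rw [hLE, hval] at h3
  have hs1 : ∀ {M : Multiset (Sym2 V)}, ∀ e ∈ M.map (Sym2.map some), none ∉ e := by
    intro M e he
    obtain ⟨e, -, rfl⟩ := Multiset.mem_map.1 he
    simp [Sym2.mem_map]
  have hs2 : ∀ {M : Multiset (Sym2 V)}, ∀ e ∈ M.map (Sym2.map some), ¬ none ∈ e := hs1
  have hc1 : ∀ {M : Multiset V}, ∀ e ∈ M.map c, none ∈ e := by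
    intro M e he
    obtain ⟨v, -, rfl⟩ := Multiset.mem_map.1 he
    simp [c]
  have hc2 : ∀ {M : Multiset V}, ∀ e ∈ M.map c, ¬ none ∉ e := fun e he h => h (hc1 e he)
  refine ⟨N, X, fun t ht => ⟨h1 t ht, fun heq => ?_⟩, h2, ?_, hends, ?_⟩
  · have h5 := congrArg (Multiset.count t.1) hends
    rw [Multiset.count_eq_one_of_mem Finset.univ.nodup (Finset.mem_univ_val _)] at h5
    obtain ⟨N', rfl⟩ := Multiset.exists_cons_of_mem ht
    simp only [Multiset.map_cons, Multiset.sum_cons, ← heq, Multiset.count_add,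
      Multiset.count_singleton_self] at h5
    omega
  · refine Multiset.map_injective hs ?_
    have := congrArg (Multiset.filter (none ∉ ·)) h3
    simp only [Multiset.filter_add] at this
    rw [Multiset.filter_eq_self.2 hs1, Multiset.filter_eq_self.2 hs1, Multiset.filter_eq_nil.2 hc2,
      Multiset.filter_eq_nil.2 hc2, add_zero, add_zero] at this
    exact this.symm
  · refine Multiset.map_injective hc ?_
    have := congrArg (Multiset.filter (none ∈ ·)) h3
    simp only [Multiset.filter_add] at this
    rw [Multiset.filter_eq_nil.2 hs2, Multiset.filter_eq_nil.2 hs2, Multiset.filter_eq_self.2 hc1,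
      Multiset.filter_eq_self.2 hc1, zero_add, zero_add] at this
    exact this.symm

theorem exists_path_of_list (K : SimpleGraph V) (l : List V) (hne : l ≠ []) (hl : l.Nodup)
    (hE : ∀ e ∈ pathEdges l, e ∈ K.edgeSet) :
    ∃ p : Σ u v : V, K.Walk u v, p.2.2.IsPath ∧ l.head? = some p.1 ∧ p.2.2.support = l ∧
      (p.2.2.edges : Multiset (Sym2 V)) = pathEdges l := by
  induction l with
  | nil => exact absurd rfl hne
  | cons a l ih =>
    cases l with
    | nil => exact ⟨⟨a, a, .nil⟩, by simp⟩
    | cons b l =>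
      obtain ⟨⟨u, v, p⟩, h1, h2, h3, h4⟩ := ih (by simp) (List.nodup_cons.1 hl).2
        fun e he => hE e (by rw [pathEdges_cons_cons]; exact Multiset.mem_add.2 (.inr he))
      simp only [List.head?_cons, Option.some.injEq] at h2
      subst h2
      have hab : K.Adj a b := hE s(a, b) (by simp)
      refine ⟨⟨a, v, .cons hab p⟩, ?_, rfl, by simpa using h3, ?_⟩
      · simp only [Walk.cons_isPath_iff]
        refine ⟨h1, ?_⟩
        rw [h3]
        exact (List.nodup_cons.1 hl).1
      · simp only [Walk.edges_cons, pathEdges_cons_cons, ← h4]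
        rfl

theorem exists_paths_of_lists (K : SimpleGraph V) (φ : V ↪ V') (L : List (List V'))
    (hL : ∀ l ∈ L, l.Nodup)
    (hE : ∀ l ∈ L, ∀ e ∈ pathEdges l, ∃ e₀ ∈ K.edgeSet, Sym2.map φ e₀ = e) :
    ∃ P : List (Σ u v : V, K.Walk u v), P.length ≤ L.length ∧ (∀ p ∈ P, p.2.2.IsPath) ∧
      (P.map fun p => (p.2.2.edges : Multiset (Sym2 V))).sum.map (Sym2.map φ) =
        (L.map pathEdges).sum := by
  induction L with
  | nil => exact ⟨[], by simp⟩
  | cons l L ih =>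
    obtain ⟨P, h1, h2, h3⟩ := ih (fun l hl => hL l (List.mem_cons_of_mem _ hl))
      (fun l hl => hE l (List.mem_cons_of_mem _ hl))
    by_cases hlen : 2 ≤ l.length
    · have hr : l ∈ Set.range (List.map φ) := by
        rw [Set.range_list_map]
        intro v hv
        obtain ⟨e, he, hve⟩ := exists_mem_pathEdges hlen hv
        obtain ⟨e₀, -, rfl⟩ := hE l (by simp) e he
        obtain ⟨u, -, rfl⟩ := Sym2.mem_map.1 hve
        exact ⟨u, rfl⟩
      obtain ⟨l, rfl⟩ := hr
      obtain ⟨p, hp, -, -, hpE⟩ := exists_path_of_list K l (by rintro rfl; simp at hlen)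
        (List.Nodup.of_map _ (hL _ List.mem_cons_self)) (by
          intro e he
          obtain ⟨e₀, he₀, h⟩ := hE _ List.mem_cons_self (Sym2.map φ e)
            (by rw [pathEdges_map]; exact Multiset.mem_map_of_mem _ he)
          rwa [← Sym2.map.injective φ.injective h])
      refine ⟨p :: P, by simpa using h1, by simpa using ⟨hp, h2⟩, ?_⟩
      rw [List.map_cons, List.sum_cons, Multiset.map_add, h3, hpE, List.map_cons, List.sum_cons,
        pathEdges_map]
    · have : pathEdges l = 0 := by
        match l, hlen with
        | [], _ => rfl
        | [_], _ => rfl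
        | _ :: _ :: _, h => simp at h
      exact ⟨P, by simp; omega, h2, by simp [this, h3]⟩

theorem pairwise_disjoint_of_nodup_sum {α β : Type*} (f : α → List β) (P : List α)
    (h : (P.map fun p => (f p : Multiset β)).sum.Nodup) :
    P.Pairwise fun p q => ∀ e ∈ f p, e ∉ f q := by
  induction P with
  | nil => simp
  | cons p P ih =>
    rw [List.map_cons, List.sum_cons, Multiset.nodup_add] at h
    refine List.pairwise_cons.2 ⟨fun q hq e he he' => ?_, ih h.2.1⟩
    refine Multiset.disjoint_left.1 h.2.2 (by simpa using he) ?_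
    rw [← Multiset.sum_coe, ← Multiset.map_coe, mem_sum_map]
    exact ⟨q, by simpa using hq, by simpa using he'⟩

/-- A family of vertex lists whose edges are, up to an embedding, exactly the edges of `K`, each
used once, bounds the path number of `K`. -/
theorem pathNumber_le_card (K : SimpleGraph V) (φ : V ↪ V') (L : Multiset (List V'))
    (hL : ∀ l ∈ L, l.Nodup) (hnd : (L.map pathEdges).sum.Nodup)
    (hE : ∀ e, e ∈ (L.map pathEdges).sum ↔ ∃ e₀ ∈ K.edgeSet, Sym2.map φ e₀ = e) :
    K.pathNumber ≤ L.card := by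
  induction L using Quotient.inductionOn with | _ L
  obtain ⟨P, h1, h2, h3⟩ := exists_paths_of_lists K φ L hL fun l hl e he =>
    (hE e).1 (mem_sum_map.2 ⟨l, hl, he⟩)
  have h4 : (Multiset.map pathEdges (L : Multiset (List V'))).sum = (L.map pathEdges).sum := by
    rw [Multiset.map_coe, Multiset.sum_coe]
  change (Multiset.map pathEdges (L : Multiset (List V'))).sum.Nodup at hnd
  change ∀ e, e ∈ (Multiset.map pathEdges (L : Multiset (List V'))).sum ↔ _ at hE
  rw [h4, ← h3] at hnd
  have hP : K.IsPathDecomp P := by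
    refine ⟨h2, pairwise_disjoint_of_nodup_sum _ _ (Multiset.Nodup.of_map _ hnd), fun e he => ?_⟩
    have := (hE (Sym2.map φ e)).2 ⟨e, he, rfl⟩
    rw [h4, ← h3, Multiset.mem_map] at this
    obtain ⟨e', he', h⟩ := this
    rw [Sym2.map.injective φ.injective h, ← Multiset.sum_coe, ← Multiset.map_coe,
      mem_sum_map] at he'
    simpa using he'
  have : K.pathNumber ≤ P.length := Nat.sInf_le ⟨P, hP, rfl⟩
  exact this.trans h1

theorem pathEdges_two_arms {A p B : List V} {a b : V} (ha : p.head? = some a)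
    (hb : p.getLast? = some b) :
    pathEdges (A.reverse ++ p ++ B) = pathEdges (a :: A) + pathEdges p + pathEdges (b :: B) := by
  obtain ⟨q, hq⟩ : ∃ q, p = a :: q := by
    cases p with
    | nil => simp at ha
    | cons c p => simp at ha; exact ⟨p, by rw [ha]⟩
  obtain ⟨r, hr⟩ : ∃ r, p = r ++ [b] := ⟨p.dropLast, by
    have hne : p ≠ [] := by rintro rfl; simp at ha
    rw [List.getLast?_eq_some_getLast hne] at hb
    conv_lhs => rw [← List.dropLast_append_getLast hne, Option.some.inj hb]⟩
  have h1 : A.reverse ++ p ++ B = A.reverse ++ a :: (q ++ B) := by simp [hq]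
  have h2 : a :: (q ++ B) = r.reverse.reverse ++ b :: B := by
    rw [List.reverse_reverse, ← List.cons_append, ← hq, hr]; simp
  rw [h1, pathEdges_reverse_append_cons, h2, pathEdges_reverse_append_cons, add_assoc]
  congr 2
  rw [hr, ← pathEdges_reverse (r ++ [b]), List.reverse_append]
  rfl

/-- The copy of a list of vertices in layer `i`. -/
def layer (i : ℕ) (p : List V) : List (ℕ × V) := p.map (Prod.mk i)

/-- The copy of a list of layers above the vertex `w`. -/
def column (w : V) (q : List ℕ) : List (ℕ × V) := q.map (·, w)

theorem pathEdges_layer (i : ℕ) (p : List V) :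
    pathEdges (layer i p) = (pathEdges p).map (Sym2.map (Prod.mk i)) := pathEdges_map _ _

theorem pathEdges_column (w : V) (q : List ℕ) :
    pathEdges (column w q) = (pathEdges q).map (Sym2.map (·, w)) := pathEdges_map _ _

theorem nodup_layer (i : ℕ) {p : List V} (hp : p.Nodup) : (layer i p).Nodup :=
  hp.map (Prod.mk_right_injective i)

theorem nodup_column (w : V) {q : List ℕ} (hq : q.Nodup) : (column w q).Nodup :=
  hq.map (Prod.mk_left_injective w)

theorem mem_layer {i : ℕ} {p : List V} {x : ℕ × V} : x ∈ layer i p ↔ x.1 = i ∧ x.2 ∈ p := by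
  obtain ⟨j, v⟩ := x
  simp only [layer, List.mem_map, Prod.mk.injEq]
  constructor
  · rintro ⟨v, h, rfl, rfl⟩; exact ⟨rfl, h⟩
  · rintro ⟨rfl, h⟩; exact ⟨v, h, rfl, rfl⟩

theorem mem_column {w : V} {q : List ℕ} {x : ℕ × V} : x ∈ column w q ↔ x.1 ∈ q ∧ x.2 = w := by
  obtain ⟨j, v⟩ := x
  simp only [column, List.mem_map, Prod.mk.injEq]
  constructor
  · rintro ⟨v, h, rfl, rfl⟩; exact ⟨h, rfl⟩
  · rintro ⟨h, rfl⟩; exact ⟨j, h, rfl, rfl⟩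

/-- A path in layer `i` prolonged at both ends. -/
def singleRoute (A B : List (ℕ × V)) (i : ℕ) (p : List V) : List (ℕ × V) :=
  A.reverse ++ layer i p ++ B

/-- The path that follows `p` in layer `i` and then returns along `p` in layer `j`, prolonged at
both ends. -/
def doubleRoute (A B : List (ℕ × V)) (i j : ℕ) (p : List V) : List (ℕ × V) :=
  A.reverse ++ (layer i p ++ (layer j p).reverse) ++ B

theorem pathEdges_singleRoute {A B : List (ℕ × V)} {i : ℕ} {t : V × V × List V}
    (ht : IsPathTriple t) :
    pathEdges (singleRoute A B i t.2.2) =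
      pathEdges ((i, t.1) :: A) + pathEdges (layer i t.2.2) + pathEdges ((i, t.2.1) :: B) :=
  pathEdges_two_arms (by simp [layer, ht.1]) (by simp [layer, ht.2.1])

theorem pathEdges_doubleRoute {A B : List (ℕ × V)} {i j : ℕ} {t : V × V × List V}
    (ht : IsPathTriple t) :
    pathEdges (doubleRoute A B i j t.2.2) =
      pathEdges ((i, t.1) :: A) + (pathEdges (layer i t.2.2) + {s((i, t.2.1), (j, t.2.1))} +
        pathEdges (layer j t.2.2)) + pathEdges ((j, t.1) :: B) := by
  have h1 : ∀ i, (layer i t.2.2).head? = some (i, t.1) := fun i => by simp [layer, ht.1]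
  have h2 : ∀ i, (layer i t.2.2).getLast? = some (i, t.2.1) := fun i => by simp [layer, ht.2.1]
  rw [doubleRoute, pathEdges_two_arms (a := (i, t.1)) (b := (j, t.1)),
    pathEdges_append (h2 i) (b := (j, t.2.1)), pathEdges_reverse]
  · rw [List.head?_reverse, h2]
  · rw [List.head?_append, h1]; rfl
  · rw [List.getLast?_append, List.getLast?_reverse, h1]; rfl

theorem nodup_singleRoute {A B : List (ℕ × V)} {i : ℕ} {p : List V} (hp : p.Nodup)
    (hA : A.Nodup) (hB : B.Nodup) (hAi : ∀ x ∈ A, x.1 ≠ i) (hBi : ∀ x ∈ B, x.1 ≠ i)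
    (hAB : ∀ x ∈ A, x ∉ B) : (singleRoute A B i p).Nodup := by
  refine List.Nodup.append (List.Nodup.append (List.nodup_reverse.2 hA) (nodup_layer i hp) ?_)
    hB ?_
  · intro x hx hx'
    exact hAi x (List.mem_reverse.1 hx) (mem_layer.1 hx').1
  · intro x hx hx'
    rcases List.mem_append.1 hx with h | h
    · exact hAB x (List.mem_reverse.1 h) hx'
    · exact hBi x hx' (mem_layer.1 h).1

theorem nodup_doubleRoute {A B : List (ℕ × V)} {i j : ℕ} {p : List V} (hp : p.Nodup) (hij : i ≠ j)
    (hA : A.Nodup) (hB : B.Nodup) (hAi : ∀ x ∈ A, x.1 ≠ i ∧ x.1 ≠ j)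
    (hBi : ∀ x ∈ B, x.1 ≠ i ∧ x.1 ≠ j) (hAB : ∀ x ∈ A, x ∉ B) :
    (doubleRoute A B i j p).Nodup := by
  refine List.Nodup.append (List.Nodup.append (List.nodup_reverse.2 hA)
    (List.Nodup.append (nodup_layer i hp) (List.nodup_reverse.2 (nodup_layer j hp)) ?_) ?_) hB ?_
  · intro x hx hx'
    exact hij ((mem_layer.1 hx).1.symm.trans (mem_layer.1 (List.mem_reverse.1 hx')).1)
  · intro x hx hx'
    have := hAi x (List.mem_reverse.1 hx)
    rcases List.mem_append.1 hx' with h | h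
    · exact this.1 (mem_layer.1 h).1
    · exact this.2 (mem_layer.1 (List.mem_reverse.1 h)).1
  · intro x hx hx'
    have := hBi x hx'
    rcases List.mem_append.1 hx with h | h
    · exact hAB x (List.mem_reverse.1 h) hx'
    · rcases List.mem_append.1 h with h | h
      · exact this.1 (mem_layer.1 h).1
      · exact this.2 (mem_layer.1 (List.mem_reverse.1 h)).1

section Assembly

variable [Fintype V] {N X : Multiset (V × V × List V)}

theorem sum_univ_eq_mainEnds {M : Type*} [AddCommMonoid M]
    (hends : (N.map fun t => ({t.1} + {t.2.1} : Multiset V)).sum + X.map (fun t => t.1) =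
      Finset.univ.val) (g : V → M) :
    ∑ v, g v = (N.map fun t => g t.1 + g t.2.1).sum + (X.map fun t => g t.1).sum := by
  rw [Finset.sum, ← hends, Multiset.map_add, Multiset.sum_add, Multiset.map_map]
  congr 1
  clear hends
  induction N using Multiset.induction_on with
  | empty => simp
  | cons t N ih =>
    rw [Multiset.map_cons, Multiset.sum_cons, Multiset.map_add, Multiset.sum_add, ih,
      Multiset.map_cons, Multiset.sum_cons]
    simp [add_assoc]

theorem sum_even_eq_furtherEnds {M : Type*} [AddCommMonoid M] {ev : V → Prop} [DecidablePred ev]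
    (hX : X.map (fun t => t.2.1) = (Finset.univ.filter ev).val) (g : V → M) :
    ∑ v, (if ev v then g v else 0) = (X.map fun t => g t.2.1).sum := by
  rw [← Finset.sum_filter, Finset.sum, ← hX, Multiset.map_map]
  rfl

/-- Routes assembled from the paths of a decomposition of `H`. The arms `Th`, `Tl`, `Tx` prolong the
copies of the paths at their ends; the edges `Z v` that some arms at even vertices `v` borrow from
copies of the paths in `X` are accounted for by `hZ`. -/
theorem exists_routes {E : Multiset (Sym2 V)} {ev : V → Prop} [DecidablePred ev]
    (hN : ∀ t ∈ N, IsPathTriple t) (hX : ∀ t ∈ X, IsPathTriple t)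
    (hE : (N.map fun t => pathEdges t.2.2).sum + (X.map fun t => pathEdges t.2.2).sum = E)
    (hends : (N.map fun t => ({t.1} + {t.2.1} : Multiset V)).sum + X.map (fun t => t.1) =
      Finset.univ.val)
    (hlast : X.map (fun t => t.2.1) = (Finset.univ.filter ev).val)
    {m : ℕ} {pairs : Multiset (ℕ × ℕ)} (hm : 2 * pairs.card ≤ m)
    {Th Tl Tx : ℕ → V → List (ℕ × V)} {G Z : V → Multiset (Sym2 (ℕ × V))}
    {Y : V × V × List V → Multiset (Sym2 (ℕ × V))}
    (hndN : ∀ t ∈ N, ∀ i, (singleRoute (Th i t.1) (Tl i t.2.1) i t.2.2).Nodup)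
    (hndX : ∀ t ∈ X, ∀ ij ∈ pairs,
      (doubleRoute (Tx ij.1 t.1) (Tx ij.2 t.1) ij.1 ij.2 t.2.2).Nodup)
    (hh : ∀ v, ∑ i ∈ Finset.range m, pathEdges ((i, v) :: Th i v) +
      (if ev v then (pairs.map fun ij => {s((ij.1, v), (ij.2, v))}).sum else 0) =
        G v + if ev v then Z v else 0)
    (hl : ∀ v, ∑ i ∈ Finset.range m, pathEdges ((i, v) :: Tl i v) +
      (if ev v then (pairs.map fun ij => {s((ij.1, v), (ij.2, v))}).sum else 0) =
        G v + if ev v then Z v else 0)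
    (hx : ∀ t ∈ X, (pairs.map fun ij => pathEdges ((ij.1, t.1) :: Tx ij.1 t.1) +
      pathEdges ((ij.2, t.1) :: Tx ij.2 t.1)).sum + Y t +
      (if ev t.1 then (pairs.map fun ij => {s((ij.1, t.1), (ij.2, t.1))}).sum else 0) =
        G t.1 + if ev t.1 then Z t.1 else 0)
    (hZ : ∀ t ∈ X, (pairs.map fun ij => pathEdges (layer ij.1 t.2.2) +
      pathEdges (layer ij.2 t.2.2)).sum + Z t.2.1 =
        ∑ i ∈ Finset.range m, pathEdges (layer i t.2.2) + Y t) :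
    ∃ L : Multiset (List (ℕ × V)), (∀ l ∈ L, l.Nodup) ∧
      (L.map pathEdges).sum =
        ∑ v, G v + ∑ i ∈ Finset.range m, E.map (Sym2.map (Prod.mk i)) ∧
      2 * L.card ≤ m * Fintype.card V := by
  refine ⟨(N.bind fun t => (Finset.range m).val.map fun i =>
      singleRoute (Th i t.1) (Tl i t.2.1) i t.2.2) +
    (X.bind fun t => pairs.map fun ij =>
      doubleRoute (Tx ij.1 t.1) (Tx ij.2 t.1) ij.1 ij.2 t.2.2), ?_, ?_, ?_⟩
  · intro l hl
    rcases Multiset.mem_add.1 hl with h | h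
    · obtain ⟨t, ht, h⟩ := Multiset.mem_bind.1 h
      obtain ⟨i, -, rfl⟩ := Multiset.mem_map.1 h
      exact hndN t ht i
    · obtain ⟨t, ht, h⟩ := Multiset.mem_bind.1 h
      obtain ⟨ij, hij, rfl⟩ := Multiset.mem_map.1 h
      exact hndX t ht ij hij
  · set links : V → Multiset (Sym2 (ℕ × V)) := fun v =>
      (pairs.map fun ij => {s((ij.1, v), (ij.2, v))}).sum with hlinks
    set DH : V → Multiset (Sym2 (ℕ × V)) := fun v =>
      ∑ i ∈ Finset.range m, pathEdges ((i, v) :: Th i v) with hDH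
    set DL : V → Multiset (Sym2 (ℕ × V)) := fun v =>
      ∑ i ∈ Finset.range m, pathEdges ((i, v) :: Tl i v) with hDL
    set DX : V → Multiset (Sym2 (ℕ × V)) := fun v =>
      (pairs.map fun ij => pathEdges ((ij.1, v) :: Tx ij.1 v) +
        pathEdges ((ij.2, v) :: Tx ij.2 v)).sum with hDX
    set P : List V → Multiset (Sym2 (ℕ × V)) := fun p =>
      ∑ i ∈ Finset.range m, pathEdges (layer i p) with hP
    set Q : List V → Multiset (Sym2 (ℕ × V)) := fun p =>
      (pairs.map fun ij => pathEdges (layer ij.1 p) + pathEdges (layer ij.2 p)).sum with hQ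
    have e1 : ((N.bind fun t => (Finset.range m).val.map fun i =>
        singleRoute (Th i t.1) (Tl i t.2.1) i t.2.2).map pathEdges).sum =
        (N.map fun t => DH t.1 + DL t.2.1).sum + (N.map fun t => P t.2.2).sum := by
      rw [Multiset.map_bind, Multiset.sum_bind, ← Multiset.sum_map_add]
      refine congrArg _ (Multiset.map_congr rfl fun t ht => ?_)
      rw [Multiset.map_map, hDH, hDL, hP]
      simp only
      rw [← Finset.sum_add_distrib, ← Finset.sum_add_distrib]
      refine Finset.sum_congr rfl fun i _ => ?_
      rw [Function.comp, pathEdges_singleRoute (hN t ht)]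
      abel
    have e2 : ((X.bind fun t => pairs.map fun ij =>
        doubleRoute (Tx ij.1 t.1) (Tx ij.2 t.1) ij.1 ij.2 t.2.2).map pathEdges).sum =
        (X.map fun t => DX t.1).sum + (X.map fun t => Q t.2.2).sum +
          (X.map fun t => links t.2.1).sum := by
      rw [Multiset.map_bind, Multiset.sum_bind, ← Multiset.sum_map_add, ← Multiset.sum_map_add]
      refine congrArg _ (Multiset.map_congr rfl fun t ht => ?_)
      rw [Multiset.map_map, hDX, hQ, hlinks]
      simp only
      rw [← Multiset.sum_map_add, ← Multiset.sum_map_add]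
      refine congrArg _ (Multiset.map_congr rfl fun ij _ => ?_)
      rw [Function.comp, pathEdges_doubleRoute (hX t ht)]
      abel
    have e3 : ∑ v, (G v + if ev v then Z v else 0) =
        (N.map fun t => DH t.1 + DL t.2.1).sum + (X.map fun t => DX t.1).sum + (X.map Y).sum +
          ∑ v, if ev v then links v else 0 := by
      rw [sum_univ_eq_mainEnds hends,
        sum_univ_eq_mainEnds hends (fun v => if ev v then links v else 0)]
      have h1 : (N.map fun t => (G t.1 + if ev t.1 then Z t.1 else 0) +
          (G t.2.1 + if ev t.2.1 then Z t.2.1 else 0)).sum =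
          (N.map fun t => DH t.1 + DL t.2.1).sum +
          (N.map fun t => (if ev t.1 then links t.1 else 0) +
            if ev t.2.1 then links t.2.1 else 0).sum := by
        rw [← Multiset.sum_map_add]
        refine congrArg _ (Multiset.map_congr rfl fun t ht => ?_)
        rw [← hh, ← hl]
        abel
      have h2 : (X.map fun t => (G t.1 + if ev t.1 then Z t.1 else 0)).sum =
          (X.map fun t => DX t.1).sum + (X.map Y).sum +
          (X.map fun t => (if ev t.1 then links t.1 else 0)).sum := by
        rw [← Multiset.sum_map_add, ← Multiset.sum_map_add]
        refine congrArg _ (Multiset.map_congr rfl fun t ht => ?_)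
        rw [← hx t ht]
      rw [h1, h2]
      abel
    rw [Finset.sum_add_distrib, sum_even_eq_furtherEnds hlast, sum_even_eq_furtherEnds hlast] at e3
    have e4 : (X.map fun t => Q t.2.2).sum + (X.map fun t => Z t.2.1).sum =
        (X.map fun t => P t.2.2).sum + (X.map Y).sum := by
      rw [← Multiset.sum_map_add, ← Multiset.sum_map_add]
      exact congrArg _ (Multiset.map_congr rfl fun t ht => hZ t ht)
    have e5 : ∑ i ∈ Finset.range m, E.map (Sym2.map (Prod.mk i)) =
        (N.map fun t => P t.2.2).sum + (X.map fun t => P t.2.2).sum := by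
      have h : ∀ M : Multiset (V × V × List V), (M.map fun t => P t.2.2).sum =
          ∑ i ∈ Finset.range m, (M.map fun t => pathEdges t.2.2).sum.map (Sym2.map (Prod.mk i)) := by
        intro M
        induction M using Multiset.induction_on with
        | empty => simp
        | cons t M ih =>
          rw [Multiset.map_cons, Multiset.sum_cons, ih, Multiset.map_cons, Multiset.sum_cons]
          simp_rw [Multiset.map_add]
          rw [Finset.sum_add_distrib]
          simp only [hP, pathEdges_layer]
      rw [h, h, ← Finset.sum_add_distrib]
      simp only [← hE, Multiset.map_add]
    rw [Multiset.map_add, Multiset.sum_add, e1, e2, e5]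
    refine add_right_cancel (b := (X.map fun t => Z t.2.1).sum + (X.map Y).sum) ?_
    calc _ = ((N.map fun t => DH t.1 + DL t.2.1).sum + (X.map fun t => DX t.1).sum +
          (X.map Y).sum + (X.map fun t => links t.2.1).sum) + (N.map fun t => P t.2.2).sum +
          ((X.map fun t => Q t.2.2).sum + (X.map fun t => Z t.2.1).sum) := by abel
      _ = _ := by
        rw [← e3, e4]
        abel
  · have h1 := congrArg Multiset.card hends
    have h2 : (N.map fun t => ({t.1} + {t.2.1} : Multiset V)).sum.card = 2 * N.card := by
      change (N.bind fun t => ({t.1} + {t.2.1} : Multiset V)).card = _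
      rw [Multiset.card_bind]
      simp [mul_comm, Function.comp_def]
    rw [Multiset.card_add, h2, Multiset.card_map] at h1
    change _ = Fintype.card V at h1
    simp only [Multiset.card_add, Multiset.card_bind, Function.comp_def, Multiset.card_map,
      Multiset.map_const', Multiset.sum_replicate, smul_eq_mul]
    change 2 * (N.card * (Finset.range m).card + _) ≤ _
    rw [Finset.card_range, ← h1]
    nlinarith

end Assembly

/-- The edges of the member of the family with `k + 5` vertices. -/
def familyEdges (k : ℕ) : Multiset (Sym2 ℕ) :=
  {s(0, 1), s(1, 2), s(0, 2), s(2, 3), s(3, 4), s(2, 4)} +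
    ∑ s ∈ Finset.range k, {s(s + 4, s + 5)}

theorem sum_add_eq_familyEdges {F l : ℕ → Multiset (Sym2 ℕ)} {R : Multiset (Sym2 ℕ)} {b c : ℕ}
    (h₀ : ∑ i ∈ Finset.range b, F i + R = familyEdges c)
    (h : ∀ s, F (2 * s + b) + F (2 * s + b + 1) + l s =
      {s(2 * s + c + 4, 2 * s + c + 5), s(2 * s + c + 5, 2 * s + c + 6)}) (t : ℕ) :
    ∑ i ∈ Finset.range (2 * t + b), F i + (R + ∑ s ∈ Finset.range t, l s) =
      familyEdges (2 * t + c) := by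
  induction t with
  | zero => simpa using h₀
  | succ t ih =>
    have e : ∀ d, 2 * (t + 1) + d = 2 * t + d + 1 + 1 := fun d => by ring
    have h' := h t
    rw [Multiset.insert_eq_cons, ← Multiset.singleton_add] at h'
    rw [familyEdges, e, e, Finset.sum_range_succ, Finset.sum_range_succ, Finset.sum_range_succ,
      Finset.sum_range_succ, Finset.sum_range_succ]
    calc _ = ∑ i ∈ Finset.range (2 * t + b), F i + (R + ∑ s ∈ Finset.range t, l s) +
          (F (2 * t + b) + F (2 * t + b + 1) + l t) := by abel
      _ = _ := by
        rw [ih, h', familyEdges]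
        simp only [add_assoc]

/-- The arms used at an odd vertex by the paths with two main ends (at the last end if the number of
layers is odd). -/
def oddArm : ℕ → List ℕ
  | 0 => [1]
  | 1 => [2]
  | 2 => [0]
  | 3 => [2, 4]
  | 4 => [3]
  | i + 5 => [i + 4]

/-- The arms used at an even vertex if the number of layers is even. -/
def evenArm : ℕ → List ℕ
  | 0 => []
  | 1 => [2]
  | 2 => [0]
  | 3 => [4]
  | 4 => [2]
  | 5 => []
  | i + 6 => if i % 2 = 0 then [i + 5] else []

/-- The arms used at an odd vertex by the paths with one main end if the number of layers is even,
except in the last layer. -/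
def oddArmX : ℕ → List ℕ
  | 0 => [2, 3]
  | 1 => []
  | 2 => [1, 0]
  | 3 => [4, 5]
  | 4 => [2]
  | i + 5 => if i % 2 = 0 then [i + 6, i + 7] else []

/-- `Q` with the value at the last layer replaced by the empty list. -/
def truncate (m : ℕ) (Q : ℕ → List ℕ) (i : ℕ) : List ℕ := if i + 1 = m then [] else Q i

theorem sum_truncate (m : ℕ) (Q : ℕ → List ℕ) :
    ∑ i ∈ Finset.range (m + 1), pathEdges (i :: truncate (m + 1) Q i) =
      ∑ i ∈ Finset.range m, pathEdges (i :: Q i) := by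
  rw [Finset.sum_range_succ]
  simp only [truncate, if_true, pathEdges_singleton, add_zero]
  refine Finset.sum_congr rfl fun i hi => ?_
  rw [if_neg (by have := Finset.mem_range.1 hi; omega)]

theorem sum_oddArm (c t : ℕ) (hc : c ≤ 1) :
    ∑ i ∈ Finset.range (2 * t + (c + 5)), pathEdges (i :: oddArm i) = familyEdges (2 * t + c) := by
  have := sum_add_eq_familyEdges (F := fun i => pathEdges (i :: oddArm i)) (l := 0) (R := 0)
    (b := c + 5) (c := c) (by interval_cases c <;> decide) (fun s => by
      interval_cases c <;> simp [oddArm] <;>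
      exact congrArg₂ Multiset.cons Sym2.eq_swap
        (congrArg (fun e => ({e} : Multiset (Sym2 ℕ))) Sym2.eq_swap)) t
  simpa using this

theorem sum_evenArm (t : ℕ) :
    ∑ i ∈ Finset.range (2 * t + 6), pathEdges (i :: evenArm i) +
      ∑ s ∈ Finset.range (t + 3), {s(2 * s, 2 * s + 1)} = familyEdges (2 * t + 1) := by
  have := sum_add_eq_familyEdges (F := fun i => pathEdges (i :: evenArm i))
    (l := fun s => {s(2 * s + 6, 2 * s + 7)}) (R := {s(0, 1), s(2, 3), s(4, 5)})
    (b := 6) (c := 1) (by decide) (fun s => by simp [evenArm]) t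
  rw [← this, add_comm t 3, Finset.sum_range_add _ 3 t]
  congr 2
  refine Finset.sum_congr rfl fun s _ => ?_
  rw [mul_add, add_comm]

theorem sum_oddArmX (t : ℕ) :
    ∑ i ∈ Finset.range (2 * t + 6), pathEdges (i :: truncate (2 * t + 6) oddArmX i) =
      familyEdges (2 * t + 1) := by
  have := sum_add_eq_familyEdges (F := fun i => pathEdges (i :: oddArmX i)) (l := 0) (R := 0)
    (b := 5) (c := 1) (by decide) (fun s => by
      simp [oddArmX]) t
  rw [sum_truncate]
  simpa using this

theorem nodup_cons_oddArm (i : ℕ) : (i :: oddArm i).Nodup := by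
  rcases i with _ | _ | _ | _ | _ | i <;> simp [oddArm]

theorem nodup_cons_evenArm (i : ℕ) : (i :: evenArm i).Nodup := by
  rcases i with _ | _ | _ | _ | _ | _ | i <;> simp [evenArm]
  split_ifs <;> simp

theorem nodup_evenArm_pair (s : ℕ) :
    ((2 * s) :: (2 * s + 1) :: (evenArm (2 * s) ++ evenArm (2 * s + 1))).Nodup := by
  rcases s with _ | _ | _ | s
  · decide
  · decide
  · decide
  · simp [evenArm, mul_add]

theorem nodup_truncate_pair {m i j : ℕ} {Q : ℕ → List ℕ} (h : (i :: j :: (Q i ++ Q j)).Nodup) :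
    (i :: j :: (truncate m Q i ++ truncate m Q j)).Nodup := by
  refine h.sublist ?_
  refine List.Sublist.cons_cons _ (List.Sublist.cons_cons _ (List.Sublist.append ?_ ?_)) <;>
  · rw [truncate]
    split_ifs <;> simp

theorem nodup_oddArmX_pair (s : ℕ) :
    ((2 * s) :: (2 * s + 1) :: (oddArmX (2 * s) ++ oddArmX (2 * s + 1))).Nodup := by
  rcases s with _ | _ | _ | s
  · decide
  · decide
  · decide
  · simp [oddArmX, mul_add]

theorem pathEdges_cons_column (i : ℕ) (v : V) (q : List ℕ) :
    pathEdges ((i, v) :: column v q) = (pathEdges (i :: q)).map (Sym2.map (·, v)) :=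
  pathEdges_column v (i :: q)

theorem sum_pathEdges_column (m : ℕ) (v : V) (Q : ℕ → List ℕ) :
    ∑ i ∈ Finset.range m, pathEdges ((i, v) :: column v (Q i)) =
      (∑ i ∈ Finset.range m, pathEdges (i :: Q i)).map (Sym2.map (·, v)) := by
  simp only [pathEdges_cons_column]
  exact (map_sum (Multiset.mapAddMonoidHom (Sym2.map (·, v))) _ _).symm

theorem sum_links_column (v : V) (pairs : Multiset (ℕ × ℕ)) :
    (pairs.map fun ij => ({s((ij.1, v), (ij.2, v))} : Multiset (Sym2 (ℕ × V)))).sum =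
      (pairs.map fun ij => ({s(ij.1, ij.2)} : Multiset (Sym2 ℕ))).sum.map (Sym2.map (·, v)) := by
  have := map_multiset_sum (Multiset.mapAddMonoidHom (Sym2.map (·, v)))
    (pairs.map fun ij => ({s(ij.1, ij.2)} : Multiset (Sym2 ℕ)))
  rw [Multiset.map_map] at this
  exact this.symm

theorem disjoint_column {v w : V} (h : v ≠ w) (p q : List ℕ) : ∀ x ∈ column v p, x ∉ column w q :=
  fun _ hx hx' => h ((mem_column.1 hx).2.symm.trans (mem_column.1 hx').2)

theorem nodup_doubleRoute_column {i j : ℕ} {p : List V} (hp : p.Nodup) {v : V} {q r : List ℕ}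
    (h : (i :: j :: (q ++ r)).Nodup) : (doubleRoute (column v q) (column v r) i j p).Nodup := by
  simp only [List.nodup_cons, List.mem_cons, List.mem_append, not_or, List.nodup_append] at h
  refine nodup_doubleRoute hp h.1.1 (nodup_column v h.2.2.1) (nodup_column v h.2.2.2.1) ?_ ?_ ?_
  · intro x hx
    have := (mem_column.1 hx).1
    exact ⟨fun e => h.1.2.1 (e ▸ this), fun e => h.2.1.1 (e ▸ this)⟩
  · intro x hx
    have := (mem_column.1 hx).1
    exact ⟨fun e => h.1.2.2 (e ▸ this), fun e => h.2.1.2 (e ▸ this)⟩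
  · exact fun x hx hx' => h.2.2.2.2 _ (mem_column.1 hx).1 _ (mem_column.1 hx').1 rfl

theorem sum_range_two_mul {M : Type*} [AddCommMonoid M] (f : ℕ → M) (k : ℕ) :
    ∑ s ∈ Finset.range k, (f (2 * s) + f (2 * s + 1)) = ∑ i ∈ Finset.range (2 * k), f i := by
  induction k with
  | zero => simp
  | succ k ih =>
    rw [Finset.sum_range_succ, ih, show 2 * (k + 1) = 2 * k + 1 + 1 by ring, Finset.sum_range_succ,
      Finset.sum_range_succ, add_assoc]

theorem sum_map_map_range {α M : Type*} [AddCommMonoid M] (k : ℕ) (g : ℕ → α) (f : α → M) :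
    (((Finset.range k).val.map g).map f).sum = ∑ s ∈ Finset.range k, f (g s) := by
  rw [Multiset.map_map]
  rfl

/-- The arms used at an even vertex by the first ends of the paths with two main ends if the number
of layers is odd. -/
def evenArmFst : ℕ → List ℕ
  | 0 => [2]
  | 1 => []
  | 2 => [1]
  | 3 => [2]
  | 4 => [2]
  | i + 5 => if i % 2 = 0 then [i + 4] else []

/-- The arms used at an even vertex by the last ends of the paths with two main ends if the number
of layers is odd. -/
def evenArmLast : ℕ → List ℕ
  | 0 => []
  | 1 => [2]
  | 2 => [0]
  | 3 => [2]
  | 4 => [2]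
  | i + 5 => if i % 2 = 0 then [i + 4] else []

/-- The arms used at an even vertex by the paths with one main end if the number of layers is odd.
The one in layer `2` is used indirectly. -/
def evenArmX : ℕ → List ℕ
  | 0 => [2]
  | 1 => []
  | 2 => [4]
  | 3 => [2, 1]
  | 4 => []
  | i + 5 => if i % 2 = 0 then [i + 4] else []

/-- The arms used at an odd vertex by the first ends of the paths with two main ends if the number
of layers is odd. -/
def oddArmFst : ℕ → List ℕ
  | 0 => [2]
  | 1 => [0]
  | 2 => [1]
  | 3 => [2, 4]
  | 4 => [3]
  | i + 5 => [i + 4]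

/-- The arms used at an odd vertex by the paths with one main end if the number of layers is odd,
except in the last layer. -/
def oddArmX' : ℕ → List ℕ
  | 0 => []
  | 1 => [2, 4, 3]
  | 2 => []
  | 3 => [2, 0, 1]
  | i + 4 => if i % 2 = 0 then [i + 5, i + 6] else []

theorem sum_evenArm_of_odd {Q : ℕ → List ℕ}
    (h₀ : ∑ i ∈ Finset.range 5, pathEdges (i :: Q i) + {s(0, 1), s(3, 4)} = familyEdges 0)
    (h : ∀ i, Q (i + 5) = if i % 2 = 0 then [i + 4] else []) (t : ℕ) :
    ∑ i ∈ Finset.range (2 * t + 5), pathEdges (i :: Q i) +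
      ({s(0, 1)} + ∑ s ∈ Finset.range (t + 1), {s(2 * s + 3, 2 * s + 4)}) = familyEdges (2 * t) := by
  have := sum_add_eq_familyEdges (F := fun i => pathEdges (i :: Q i))
    (l := fun s => {s(2 * s + 5, 2 * s + 6)}) h₀ (fun s => by
      have := h (2 * s + 1)
      rw [show 2 * s + 1 + 5 = 2 * s + 5 + 1 by ring] at this
      rw [h, this]
      simp [Sym2.eq_swap]) t
  rw [add_zero] at this
  rw [← this, add_comm t 1, Finset.sum_range_add _ 1 t]
  congr 1
  rw [← add_assoc]
  congr 1
  refine Finset.sum_congr rfl fun s _ => ?_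
  rw [show 2 * (1 + s) = 2 * s + 2 by ring]

theorem sum_oddArmFst (t : ℕ) :
    ∑ i ∈ Finset.range (2 * t + 5), pathEdges (i :: oddArmFst i) = familyEdges (2 * t) := by
  have := sum_add_eq_familyEdges (F := fun i => pathEdges (i :: oddArmFst i)) (l := 0) (R := 0)
    (b := 5) (c := 0) (by decide) (fun s => by
      simp [oddArmFst]
      exact congrArg₂ Multiset.cons Sym2.eq_swap
        (congrArg (fun e => ({e} : Multiset (Sym2 ℕ))) Sym2.eq_swap)) t
  simpa using this

theorem sum_oddArmX' (t : ℕ) :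
    ∑ i ∈ Finset.range (2 * t + 5), pathEdges (i :: truncate (2 * t + 5) oddArmX' i) =
      familyEdges (2 * t) := by
  have := sum_add_eq_familyEdges (F := fun i => pathEdges (i :: oddArmX' i)) (l := 0) (R := 0)
    (b := 4) (c := 0) (by decide) (fun s => by simp [oddArmX']) t
  rw [sum_truncate]
  simpa using this

theorem nodup_cons_evenArmFst (i : ℕ) : (i :: evenArmFst i).Nodup := by
  rcases i with _ | _ | _ | _ | _ | i <;> simp [evenArmFst]
  split_ifs <;> simp

theorem nodup_cons_evenArmLast (i : ℕ) : (i :: evenArmLast i).Nodup := by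
  rcases i with _ | _ | _ | _ | _ | i <;> simp [evenArmLast]
  split_ifs <;> simp

theorem nodup_cons_oddArmFst (i : ℕ) : (i :: oddArmFst i).Nodup := by
  rcases i with _ | _ | _ | _ | _ | i <;> simp [oddArmFst]

theorem nodup_evenArmX_pair (s : ℕ) :
    ((2 * s + 3) :: (2 * s + 4) :: (evenArmX (2 * s + 3) ++ evenArmX (2 * s + 4))).Nodup := by
  rcases s with _ | s
  · decide
  · simp [evenArmX, mul_add]

theorem nodup_oddArmX'_pair (s : ℕ) :
    ((2 * s + 3) :: (2 * s + 4) :: (oddArmX' (2 * s + 3) ++ oddArmX' (2 * s + 4))).Nodup := by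
  rcases s with _ | s
  · decide
  · simp [oddArmX', mul_add]

theorem sum_pairs_of_odd {M : Type*} [AddCommMonoid M] (f : ℕ → M) (t : ℕ) :
    f 0 + f 1 + ∑ s ∈ Finset.range (t + 1), (f (2 * s + 3) + f (2 * s + 4)) + f 2 =
      ∑ i ∈ Finset.range (2 * t + 5), f i := by
  induction t with
  | zero =>
    simp [Finset.sum_range_succ]
    abel
  | succ t ih =>
    rw [show 2 * (t + 1) + 5 = 2 * t + 5 + 1 + 1 by ring, Finset.sum_range_succ,
      Finset.sum_range_succ _ (2 * t + 5 + 1), Finset.sum_range_succ _ (2 * t + 5), ← ih,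
      show 2 * (t + 1) + 3 = 2 * t + 5 by ring, show 2 * (t + 1) + 4 = 2 * t + 5 + 1 by ring]
    abel

/-- The arms given by `Q`, except that at an even vertex the arm in layer `k` is `R`. -/
def linkedArm (ev : V → Prop) [DecidablePred ev] (R : V → List (ℕ × V)) (k : ℕ)
    (Q : ℕ → List ℕ) (i : ℕ) (v : V) : List (ℕ × V) :=
  if ev v ∧ i = k then R v else column v (Q i)

section LinkedArm

variable {ev : V → Prop} [DecidablePred ev]

theorem sum_linkedArm {R : V → List (ℕ × V)} {k m : ℕ} (hk : k < m) {Q : ℕ → List ℕ} {v : V}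
    {Z : Multiset (Sym2 (ℕ × V))} (hv : ev v)
    (h : pathEdges ((k, v) :: R v) = pathEdges ((k, v) :: column v (Q k)) + Z) :
    ∑ i ∈ Finset.range m, pathEdges ((i, v) :: linkedArm ev R k Q i v) =
      (∑ i ∈ Finset.range m, pathEdges (i :: Q i)).map (Sym2.map (·, v)) + Z := by
  rw [← sum_pathEdges_column]
  have : ∀ i, pathEdges ((i, v) :: linkedArm ev R k Q i v) =
      pathEdges ((i, v) :: column v (Q i)) + if i = k then Z else 0 := by
    intro i
    by_cases hi : i = k
    · subst hi
      rw [linkedArm, if_pos ⟨hv, rfl⟩, if_pos rfl, h]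
    · rw [linkedArm, if_neg fun h => hi h.2, if_neg hi, add_zero]
  simp only [this, Finset.sum_add_distrib]
  rw [Finset.sum_ite_eq', if_pos (Finset.mem_range.2 hk)]

theorem linkedArm_of_not {R : V → List (ℕ × V)} {k i : ℕ} {Q : ℕ → List ℕ} {v : V} (hv : ¬ ev v) :
    linkedArm ev R k Q i v = column v (Q i) := if_neg fun h => hv h.1

theorem linkedArm_of_ne {R : V → List (ℕ × V)} {k i : ℕ} {Q : ℕ → List ℕ} {v : V} (hi : i ≠ k) :
    linkedArm ev R k Q i v = column v (Q i) := if_neg fun h => hi h.2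

theorem linkedArm_self {R : V → List (ℕ × V)} {k : ℕ} {Q : ℕ → List ℕ} {v : V} (hv : ev v) :
    linkedArm ev R k Q k v = R v := if_pos ⟨hv, rfl⟩

theorem nodup_linkedArm {R : V → List (ℕ × V)} {k i : ℕ} {Q : ℕ → List ℕ} {v : V}
    (hR : ev v → (R v).Nodup) (hQ : (Q i).Nodup) : (linkedArm ev R k Q i v).Nodup := by
  rw [linkedArm]
  split_ifs with h
  exacts [hR h.1, nodup_column _ hQ]

theorem fst_of_mem_linkedArm {R : V → List (ℕ × V)} {k i : ℕ} {Q : ℕ → List ℕ} {v : V} {S : List ℕ}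
    (hR : ev v → i = k → ∀ x ∈ R v, x.1 ∈ S) (hQ : ∀ j ∈ Q i, ev v ∧ i = k ∨ j ∈ S) :
    ∀ x ∈ linkedArm ev R k Q i v, x.1 ∈ S := by
  intro x hx
  rw [linkedArm] at hx
  split_ifs at hx with h
  · exact hR h.1 h.2 x hx
  · exact (hQ _ (mem_column.1 hx).1).resolve_left h

end LinkedArm

theorem nodup_singleRoute_of_fst {i : ℕ} {p : List V} {A B : List (ℕ × V)} {S T : List ℕ}
    (hp : p.Nodup) (hA : A.Nodup) (hB : B.Nodup) (hAS : ∀ x ∈ A, x.1 ∈ S) (hBT : ∀ x ∈ B, x.1 ∈ T)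
    (h : (i :: (S ++ T)).Nodup) : (singleRoute A B i p).Nodup := by
  obtain ⟨h1, h2⟩ := List.nodup_cons.1 h
  refine nodup_singleRoute hp hA hB (fun x hx e => ?_) (fun x hx e => ?_) fun x hx hx' => ?_
  · exact h1 (List.mem_append_left _ (e ▸ hAS x hx))
  · exact h1 (List.mem_append_right _ (e ▸ hBT x hx))
  · exact List.disjoint_of_nodup_append h2 (hAS x hx) (hBT x hx')

section Layers

variable [Fintype V] {N X : Multiset (V × V × List V)} {E : Multiset (Sym2 V)} {ev : V → Prop}
  [DecidablePred ev]

theorem exists_routes_of_even (hN : ∀ t ∈ N, IsPathTriple t ∧ t.1 ≠ t.2.1)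
    (hX : ∀ t ∈ X, IsPathTriple t)
    (hE : (N.map fun t => pathEdges t.2.2).sum + (X.map fun t => pathEdges t.2.2).sum = E)
    (hends : (N.map fun t => ({t.1} + {t.2.1} : Multiset V)).sum + X.map (fun t => t.1) =
      Finset.univ.val)
    (hlast : X.map (fun t => t.2.1) = (Finset.univ.filter ev).val) (t : ℕ) :
    ∃ L : Multiset (List (ℕ × V)), (∀ l ∈ L, l.Nodup) ∧
      (L.map pathEdges).sum = ∑ v, (familyEdges (2 * t + 1)).map (Sym2.map (·, v)) +
        ∑ i ∈ Finset.range (2 * t + 6), E.map (Sym2.map (Prod.mk i)) ∧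
      2 * L.card ≤ (2 * t + 6) * Fintype.card V := by
  have hcol : ∀ (Q : ℕ → List ℕ), ∑ i ∈ Finset.range (2 * t + 6), pathEdges (i :: Q i) =
      familyEdges (2 * t + 1) → ∀ v : V, ¬ ev v → ∀ Q' : ℕ → List ℕ,
      ∑ i ∈ Finset.range (2 * t + 6), pathEdges ((i, v) :: column v (if ev v then Q' i else Q i)) =
        (familyEdges (2 * t + 1)).map (Sym2.map (·, v)) := by
    intro Q hQ v hv Q'
    simp only [if_neg hv]
    rw [sum_pathEdges_column, hQ]
  have hcol' : ∀ v : V, ev v → ∀ Q' : ℕ → List ℕ,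
      ∑ i ∈ Finset.range (2 * t + 6),
        pathEdges ((i, v) :: column v (if ev v then evenArm i else Q' i)) +
      (((Finset.range (t + 3)).val.map fun s => (2 * s, 2 * s + 1)).map fun ij : ℕ × ℕ =>
        ({s((ij.1, v), (ij.2, v))} : Multiset (Sym2 (ℕ × V)))).sum =
        (familyEdges (2 * t + 1)).map (Sym2.map (·, v)) := by
    intro v hv Q'
    simp only [if_pos hv]
    rw [sum_pathEdges_column, sum_links_column, ← sum_evenArm, Multiset.map_add, sum_map_map_range]
  refine exists_routes (pairs := (Finset.range (t + 3)).val.map fun s => (2 * s, 2 * s + 1))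
    (Th := fun i v => column v (if ev v then evenArm i else oddArm i))
    (Tl := fun i v => column v (if ev v then evenArm i else oddArm i))
    (Tx := fun i v => column v (if ev v then evenArm i else truncate (2 * t + 6) oddArmX i))
    (Z := 0) (Y := 0)
    (fun u hu => (hN u hu).1) hX hE hends hlast ?_ ?_ ?_ ?_ ?_ ?_ ?_
  · rw [Multiset.card_map]
    change 2 * (Finset.range (t + 3)).card ≤ _
    rw [Finset.card_range]
    omega
  · intro u hu i
    have h : ∀ v, (i :: if ev v then evenArm i else oddArm i).Nodup := by
      intro v
      split_ifs
      exacts [nodup_cons_evenArm i, nodup_cons_oddArm i]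
    refine nodup_singleRoute (hN u hu).1.2.2 (nodup_column _ (List.nodup_cons.1 (h _)).2)
      (nodup_column _ (List.nodup_cons.1 (h _)).2) ?_ ?_ (disjoint_column (hN u hu).2 _ _)
    · exact fun x hx e => (List.nodup_cons.1 (h _)).1 (e ▸ (mem_column.1 hx).1)
    · exact fun x hx e => (List.nodup_cons.1 (h _)).1 (e ▸ (mem_column.1 hx).1)
  · intro u hu ij hij
    obtain ⟨s, -, rfl⟩ := Multiset.mem_map.1 hij
    refine nodup_doubleRoute_column (hX u hu).2.2 ?_
    split_ifs
    exacts [nodup_evenArm_pair s, nodup_truncate_pair (nodup_oddArmX_pair s)]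
  · intro v
    by_cases hv : ev v
    · rw [if_pos hv, hcol' v hv]; simp
    · rw [if_neg hv, hcol _ (sum_oddArm 1 t le_rfl) v hv]; simp
  · intro v
    by_cases hv : ev v
    · rw [if_pos hv, hcol' v hv]; simp
    · rw [if_neg hv, hcol _ (sum_oddArm 1 t le_rfl) v hv]; simp
  · intro u hu
    rw [sum_map_map_range, sum_range_two_mul (fun i => pathEdges ((i, u.1) :: column u.1
      (if ev u.1 then evenArm i else truncate (2 * t + 6) oddArmX i)))]
    change ∑ i ∈ Finset.range (2 * t + 6), _ + _ + _ = _
    by_cases hv : ev u.1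
    · rw [if_pos hv, Pi.zero_apply, add_zero, hcol' u.1 hv]; simp
    · rw [if_neg hv, hcol _ (sum_oddArmX t) u.1 hv]; simp
  · intro u hu
    rw [sum_map_map_range, sum_range_two_mul (fun i => pathEdges (layer i u.2.2))]
    rfl

set_option maxHeartbeats 1000000 in
theorem exists_routes_of_odd (hN : ∀ t ∈ N, IsPathTriple t ∧ t.1 ≠ t.2.1)
    (hX : ∀ t ∈ X, IsPathTriple t)
    (hE : (N.map fun t => pathEdges t.2.2).sum + (X.map fun t => pathEdges t.2.2).sum = E)
    (hends : (N.map fun t => ({t.1} + {t.2.1} : Multiset V)).sum + X.map (fun t => t.1) =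
      Finset.univ.val)
    (hlast : X.map (fun t => t.2.1) = (Finset.univ.filter ev).val) (t : ℕ) :
    ∃ L : Multiset (List (ℕ × V)), (∀ l ∈ L, l.Nodup) ∧
      (L.map pathEdges).sum = ∑ v, (familyEdges (2 * t)).map (Sym2.map (·, v)) +
        ∑ i ∈ Finset.range (2 * t + 5), E.map (Sym2.map (Prod.mk i)) ∧
      2 * L.card ≤ (2 * t + 5) * Fintype.card V := by
  have hP : ∀ v, ∃ u : V × V × List V, ev v → u ∈ X ∧ u.2.1 = v := by
    intro v
    by_cases hv : ev v
    · have : v ∈ X.map fun t => t.2.1 := by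
        rw [hlast]
        simpa using hv
      obtain ⟨u, hu⟩ := Multiset.mem_map.1 this
      exact ⟨u, fun _ => hu⟩
    · exact ⟨(v, v, []), fun h => absurd h hv⟩
  choose P hP using hP
  have hPX : ∀ u ∈ X, ev u.2.1 ∧ P u.2.1 = u := by
    intro u hu
    have hev : ev u.2.1 := by
      have : u.2.1 ∈ X.map fun t => t.2.1 := Multiset.mem_map_of_mem _ hu
      rw [hlast] at this
      simpa using this
    refine ⟨hev, Multiset.inj_on_of_nodup_map (f := fun t => t.2.1) ?_ _ (hP _ hev).1 _ hu
      (hP _ hev).2⟩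
    rw [hlast]
    exact Finset.nodup _
  set Qx : V → ℕ → List ℕ := fun v =>
    if ev v then evenArmX else truncate (2 * t + 5) oddArmX' with hQx
  have hQx2 : ∀ v, ∀ j ∈ Qx v 2, j = 4 := by
    intro v
    simp only [hQx]
    split_ifs
    · simp [evenArmX]
    · simp [truncate, oddArmX']
  have hQx2' : ∀ v, (Qx v 2).Nodup := by
    intro v
    simp only [hQx]
    split_ifs
    · simp [evenArmX]
    · simp [truncate, oddArmX']
  set Y : V × V × List V → Multiset (Sym2 (ℕ × V)) := fun u =>
    pathEdges ((2, u.1) :: column u.1 (Qx u.1 2)) with hY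
  set R : V → List (ℕ × V) := fun v =>
    (layer 2 (P v).2.2).reverse ++ column (P v).1 (Qx (P v).1 2) with hR
  set Z : V → Multiset (Sym2 (ℕ × V)) := fun v =>
    pathEdges (layer 2 (P v).2.2) + Y (P v) with hZ
  have hRnd : ∀ v, ev v → (R v).Nodup := by
    intro v hv
    refine List.Nodup.append (List.nodup_reverse.2 (nodup_layer 2 (hX _ (hP v hv).1).2.2))
      (nodup_column _ (hQx2' _)) ?_
    intro x hx hx'
    have h1 := (mem_layer.1 (List.mem_reverse.1 hx)).1
    have h2 := hQx2 _ _ (mem_column.1 hx').1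
    omega
  have hRfst : ∀ v, ∀ x ∈ R v, x.1 ∈ [2, 4] := by
    intro v x hx
    rcases List.mem_append.1 hx with h | h
    · simp [(mem_layer.1 (List.mem_reverse.1 h)).1]
    · simp [hQx2 _ _ (mem_column.1 h).1]
  have hRedges : ∀ k v, ev v → ∀ Q : ℕ → List ℕ, Q k = [2] →
      pathEdges ((k, v) :: R v) = pathEdges ((k, v) :: column v (Q k)) + Z v := by
    intro k v hv Q hQ
    obtain ⟨hPm, hPv⟩ := hP v hv
    have hlst : (layer 2 (P v).2.2).getLast? = some (2, v) := by
      simp [layer, (hX _ hPm).2.1, hPv]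
    have hhead : (layer 2 (P v).2.2).head? = some (2, (P v).1) := by
      simp [layer, (hX _ hPm).1]
    have h1 := pathEdges_two_arms (A := [(k, v)]) (p := (layer 2 (P v).2.2).reverse)
      (B := column (P v).1 (Qx (P v).1 2)) (a := (2, v)) (b := (2, (P v).1))
      (by rw [List.head?_reverse, hlst]) (by rw [List.getLast?_reverse, hhead])
    have h2 : [(k, v)].reverse ++ (layer 2 (P v).2.2).reverse ++ column (P v).1 (Qx (P v).1 2) =
        (k, v) :: R v := by simp [hR]
    rw [← h2, h1, hQ, pathEdges_reverse, hZ, hY, ← add_assoc]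
    congr 2
    simp [column, Sym2.eq_swap]
  set pairs : Multiset (ℕ × ℕ) :=
    (0, 1) ::ₘ (Finset.range (t + 1)).val.map fun s => (2 * s + 3, 2 * s + 4) with hpairs
  have hlinks : ∀ v : V, (pairs.map fun ij => ({s((ij.1, v), (ij.2, v))} :
      Multiset (Sym2 (ℕ × V)))).sum = (({s(0, 1)} +
        ∑ s ∈ Finset.range (t + 1), {s(2 * s + 3, 2 * s + 4)} : Multiset (Sym2 ℕ))).map
          (Sym2.map (·, v)) := by
    intro v
    rw [sum_links_column, hpairs, Multiset.map_cons, Multiset.sum_cons, sum_map_map_range]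
  have hsum : ∀ f : ℕ → Multiset (Sym2 (ℕ × V)), (pairs.map fun ij => f ij.1 + f ij.2).sum + f 2 =
      ∑ i ∈ Finset.range (2 * t + 5), f i := by
    intro f
    rw [hpairs, Multiset.map_cons, Multiset.sum_cons, sum_map_map_range, ← sum_pairs_of_odd]
  have heven : ∀ {Q : ℕ → List ℕ} {k : ℕ} (v : V), ev v → k < 2 * t + 5 → Q k = [2] →
      ∑ i ∈ Finset.range 5, pathEdges (i :: Q i) + {s(0, 1), s(3, 4)} = familyEdges 0 →
      (∀ i, Q (i + 5) = if i % 2 = 0 then [i + 4] else []) →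
      ∑ i ∈ Finset.range (2 * t + 5), pathEdges ((i, v) :: linkedArm ev R k Q i v) +
        (pairs.map fun ij => ({s((ij.1, v), (ij.2, v))} : Multiset (Sym2 (ℕ × V)))).sum =
        (familyEdges (2 * t)).map (Sym2.map (·, v)) + Z v := by
    intro Q k v hv hk hQk h0 h5
    rw [sum_linkedArm hk hv (hRedges k v hv Q hQk), ← sum_evenArm_of_odd h0 h5 t, hlinks,
      Multiset.map_add _ _ ({s(0, 1)} + _)]
    abel
  have hodd : ∀ {Q : ℕ → List ℕ} {k : ℕ} (v : V), ¬ ev v →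
      ∑ i ∈ Finset.range (2 * t + 5), pathEdges (i :: Q i) = familyEdges (2 * t) →
      ∑ i ∈ Finset.range (2 * t + 5), pathEdges ((i, v) :: linkedArm ev R k Q i v) =
        (familyEdges (2 * t)).map (Sym2.map (·, v)) := by
    intro Q k v hv h
    simp only [linkedArm_of_not hv]
    rw [sum_pathEdges_column, h]
  set Qh : V → ℕ → List ℕ := fun v => if ev v then evenArmFst else oddArmFst with hQh
  set Ql : V → ℕ → List ℕ := fun v => if ev v then evenArmLast else oddArm with hQl
  have hQh' : ∀ v i, (i :: Qh v i).Nodup := by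
    intro v i
    simp only [hQh]
    split_ifs
    exacts [nodup_cons_evenArmFst i, nodup_cons_oddArmFst i]
  have hQl' : ∀ v i, (i :: Ql v i).Nodup := by
    intro v i
    simp only [hQl]
    split_ifs
    exacts [nodup_cons_evenArmLast i, nodup_cons_oddArm i]
  refine exists_routes (pairs := pairs) (Th := fun i v => linkedArm ev R 0 (Qh v) i v)
    (Tl := fun i v => linkedArm ev R 1 (Ql v) i v) (Tx := fun i v => linkedArm ev R 0 (Qx v) i v)
    (Z := Z) (Y := Y) (fun u hu => (hN u hu).1) hX hE hends hlast ?_ ?_ ?_ ?_ ?_ ?_ ?_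
  · rw [hpairs, Multiset.card_cons, Multiset.card_map]
    change 2 * ((Finset.range (t + 1)).card + 1) ≤ _
    rw [Finset.card_range]
    omega
  · intro u hu i
    have h1 : ∀ v, (linkedArm ev R 0 (Qh v) i v).Nodup := fun v =>
      nodup_linkedArm (hRnd v) (List.nodup_cons.1 (hQh' v i)).2
    have h2 : ∀ v, (linkedArm ev R 1 (Ql v) i v).Nodup := fun v =>
      nodup_linkedArm (hRnd v) (List.nodup_cons.1 (hQl' v i)).2
    obtain rfl | rfl | hi : i = 0 ∨ i = 1 ∨ 2 ≤ i := by omega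
    · have h3 : ∀ v, ∀ x ∈ linkedArm ev R 0 (Qh v) 0 v, x.1 ∈ [2, 4] := fun v =>
        fst_of_mem_linkedArm (fun _ _ => hRfst v) (by
          simp only [hQh]; split_ifs <;> simp [evenArmFst, oddArmFst])
      have h4 : ∀ v, ∀ x ∈ linkedArm ev R 1 (Ql v) 0 v, x.1 ∈ [1] := fun v =>
        fst_of_mem_linkedArm (by simp) (by
          simp only [hQl]; split_ifs <;> simp [evenArmLast, oddArm])
      exact nodup_singleRoute_of_fst (hN u hu).1.2.2 (h1 _) (h2 _) (h3 _) (h4 _) (by decide)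
    · have h3 : ∀ v, ∀ x ∈ linkedArm ev R 0 (Qh v) 1 v, x.1 ∈ [0] := fun v =>
        fst_of_mem_linkedArm (by simp) (by
          simp only [hQh]; split_ifs <;> simp [evenArmFst, oddArmFst])
      have h4 : ∀ v, ∀ x ∈ linkedArm ev R 1 (Ql v) 1 v, x.1 ∈ [2, 4] := fun v =>
        fst_of_mem_linkedArm (fun _ _ => hRfst v) (by
          simp only [hQl]; split_ifs <;> simp [evenArmLast, oddArm])
      exact nodup_singleRoute_of_fst (hN u hu).1.2.2 (h1 _) (h2 _) (h3 _) (h4 _) (by decide)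
    · refine nodup_singleRoute (hN u hu).1.2.2 (h1 _) (h2 _) ?_ ?_ ?_
      · intro x hx e
        rw [linkedArm_of_ne (by omega)] at hx
        exact (List.nodup_cons.1 (hQh' _ _)).1 (e ▸ (mem_column.1 hx).1)
      · intro x hx e
        rw [linkedArm_of_ne (by omega)] at hx
        exact (List.nodup_cons.1 (hQl' _ _)).1 (e ▸ (mem_column.1 hx).1)
      · rw [linkedArm_of_ne (by omega), linkedArm_of_ne (by omega)]
        exact disjoint_column (hN u hu).2 _ _
  · intro u hu ij hij
    have hnd := (hX u hu).2.2
    rcases Multiset.mem_cons.1 hij with rfl | hij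
    · by_cases hv : ev u.1
      · have h1 : column u.1 (Qx u.1 1) = [] := by simp [hQx, if_pos hv, evenArmX, column]
        rw [linkedArm_self hv, linkedArm_of_ne one_ne_zero, h1]
        refine nodup_doubleRoute hnd zero_ne_one (hRnd _ hv) (by simp) ?_ (by simp) (by simp)
        intro x hx
        have h2 := hRfst _ x hx
        simp only [List.mem_cons, List.not_mem_nil, or_false] at h2
        omega
      · rw [linkedArm_of_not hv, linkedArm_of_not hv]
        refine nodup_doubleRoute_column hnd ?_
        simp only [hQx, if_neg hv]
        exact nodup_truncate_pair (by decide)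
    · obtain ⟨s, -, rfl⟩ := Multiset.mem_map.1 hij
      rw [linkedArm_of_ne (by omega), linkedArm_of_ne (by omega)]
      refine nodup_doubleRoute_column hnd ?_
      simp only [hQx]
      split_ifs
      exacts [nodup_evenArmX_pair s, nodup_truncate_pair (nodup_oddArmX'_pair s)]
  · intro v
    by_cases hv : ev v
    · rw [if_pos hv, if_pos hv]
      simp only [hQh, if_pos hv]
      exact heven v hv (by omega) rfl (by decide) fun _ => rfl
    · rw [if_neg hv, if_neg hv]
      simp only [hQh, if_neg hv]
      rw [hodd v hv (sum_oddArmFst t)]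
  · intro v
    by_cases hv : ev v
    · rw [if_pos hv, if_pos hv]
      simp only [hQl, if_pos hv]
      exact heven v hv (by omega) rfl (by decide) fun _ => rfl
    · rw [if_neg hv, if_neg hv]
      simp only [hQl, if_neg hv]
      rw [hodd v hv (sum_oddArm 0 t (by omega))]
  · intro u hu
    have h1 := hsum fun i => pathEdges ((i, u.1) :: linkedArm ev R 0 (Qx u.1) i u.1)
    rw [linkedArm_of_ne two_ne_zero] at h1
    rw [h1]
    by_cases hv : ev u.1
    · rw [if_pos hv, if_pos hv]
      simp only [hQx, if_pos hv]
      exact heven u.1 hv (by omega) rfl (by decide) fun _ => rfl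
    · rw [if_neg hv, if_neg hv]
      simp only [hQx, if_neg hv]
      rw [hodd u.1 hv (sum_oddArmX' t)]
  · intro u hu
    change _ + (pathEdges (layer 2 (P u.2.1).2.2) + Y (P u.2.1)) = _
    rw [(hPX u hu).2, ← add_assoc, hsum fun i => pathEdges (layer i u.2.2)]

end Layers

theorem mem_familyEdges {k a b : ℕ} (hab : a < b) :
    s(a, b) ∈ familyEdges k ↔
      b < k + 5 ∧ b = a + 1 ∨ a = 0 ∧ b = 2 ∨ a = 2 ∧ b = 4 := by
  simp only [familyEdges, Multiset.mem_add, Multiset.mem_sum, Multiset.mem_singleton,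
    Multiset.insert_eq_cons, Multiset.mem_cons, Sym2.eq_iff, Finset.mem_range]
  constructor
  · rintro ((h | h | h | h | h | h) | ⟨s, hs, h⟩) <;> omega
  · rintro (⟨h, rfl⟩ | h)
    · by_cases ha : a < 4
      · left
        interval_cases a <;> simp
      · exact Or.inr ⟨a - 4, by omega, by omega⟩
    · left
      rcases h with ⟨rfl, rfl⟩ | ⟨rfl, rfl⟩ <;> simp

theorem nodup_familyEdges (k : ℕ) : (familyEdges k).Nodup := by
  induction k with
  | zero => decide
  | succ k ih =>
    rw [familyEdges, Finset.sum_range_succ, ← add_assoc, ← familyEdges, add_comm,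
      Multiset.singleton_add, Multiset.nodup_cons, mem_familyEdges (by omega)]
    exact ⟨by omega, ih⟩

theorem not_isDiag_of_mem_familyEdges {k : ℕ} {e : Sym2 ℕ} (he : e ∈ familyEdges k) :
    ¬ e.IsDiag := by
  simp only [familyEdges, Multiset.mem_add, Multiset.mem_sum, Multiset.mem_singleton,
    Multiset.insert_eq_cons, Multiset.mem_cons] at he
  rcases he with (rfl | rfl | rfl | rfl | rfl | rfl) | ⟨s, -, rfl⟩ <;> simp

theorem adj_familyA_iff {k : ℕ} (a b : Fin (k + 5)) (h2 : 2 < k + 5) (h4 : 4 < k + 5)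
    (h0 : 0 < k + 5) :
    (pathGraph (k + 5) ⊔ fromEdgeSet {s((⟨0, h0⟩ : Fin (k + 5)), (⟨2, h2⟩ : Fin (k + 5))),
      s((⟨2, h2⟩ : Fin (k + 5)), (⟨4, h4⟩ : Fin (k + 5)))}).Adj a b ↔
      s((a : ℕ), (b : ℕ)) ∈ familyEdges k := by
  have ha := a.2
  have hb := b.2
  simp only [sup_adj, pathGraph_adj, fromEdgeSet_adj, Set.mem_insert_iff, Set.mem_singleton_iff,
    Sym2.eq_iff, Fin.ext_iff, ne_eq]
  rcases lt_trichotomy (a : ℕ) b with h | h | h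
  · rw [mem_familyEdges h]
    omega
  · constructor
    · omega
    · intro h'
      exact absurd (by simpa using h) (not_isDiag_of_mem_familyEdges h')
  · rw [Sym2.eq_swap, mem_familyEdges h]
    omega

theorem nodup_sum_map_mk {ι : Type*} {α β : Type*} {s : Finset ι} {A : Multiset α}
    (hA : A.Nodup) {f : ι → α → β} (hf : ∀ i j a b, f i a = f j b → i = j ∧ a = b) :
    (∑ i ∈ s, A.map (f i)).Nodup := by
  classical
  induction s using Finset.induction_on with
  | empty => simp
  | insert i s hi ih =>
    rw [Finset.sum_insert hi, Multiset.nodup_add]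
    refine ⟨hA.map fun a b h => (hf _ _ _ _ h).2, ih, Multiset.disjoint_left.2 fun {x} hx hx' => ?_⟩
    obtain ⟨a, -, rfl⟩ := Multiset.mem_map.1 hx
    obtain ⟨j, hj, hx'⟩ := Multiset.mem_sum.1 hx'
    obtain ⟨b, -, hb⟩ := Multiset.mem_map.1 hx'
    exact hi ((hf _ _ _ _ hb).1 ▸ hj)

theorem nodup_columns_add_layers [Fintype V] {A : Multiset (Sym2 ℕ)} {B : Multiset (Sym2 V)}
    (hA : A.Nodup) (hA' : ∀ e ∈ A, ¬ e.IsDiag) (hB : B.Nodup)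
    (s : Finset ℕ) :
    (∑ v, A.map (Sym2.map (·, v)) + ∑ i ∈ s, B.map (Sym2.map (Prod.mk i))).Nodup := by
  refine Multiset.nodup_add.2 ⟨nodup_sum_map_mk hA ?_, nodup_sum_map_mk hB ?_, ?_⟩
  · intro v w e e' h
    induction e with | _ a b
    induction e' with | _ c d
    simp only [Sym2.map_mk, Sym2.eq_iff, Prod.mk.injEq] at h ⊢
    tauto
  · intro v w e e' h
    induction e with | _ a b
    induction e' with | _ c d
    simp only [Sym2.map_mk, Sym2.eq_iff, Prod.mk.injEq] at h ⊢
    tauto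
  · refine Multiset.disjoint_left.2 fun {x} hx hx' => ?_
    obtain ⟨v, -, hx⟩ := Multiset.mem_sum.1 hx
    obtain ⟨e, he, rfl⟩ := Multiset.mem_map.1 hx
    obtain ⟨i, -, hx'⟩ := Multiset.mem_sum.1 hx'
    obtain ⟨e', -, h⟩ := Multiset.mem_map.1 hx'
    refine hA' e he ?_
    induction e with | _ a b
    induction e' with | _ c d
    simp only [Sym2.map_mk, Sym2.eq_iff, Prod.mk.injEq] at h
    rw [Sym2.mk_isDiag_iff]
    omega

theorem pathNumber_boxProd_le_card [Fintype V] {k : ℕ} (G : SimpleGraph (Fin k))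
    {A : Multiset (Sym2 ℕ)} (hA : A.Nodup)
    (hAG : ∀ e, e ∈ A ↔ ∃ e' ∈ G.edgeSet, Sym2.map Fin.val e' = e)
    (H : SimpleGraph V) [Fintype H.edgeSet] {L : Multiset (List (ℕ × V))} (hL : ∀ l ∈ L, l.Nodup)
    (h : (L.map pathEdges).sum = ∑ v, A.map (Sym2.map (·, v)) +
      ∑ i ∈ Finset.range k, H.edgeFinset.val.map (Sym2.map (Prod.mk i))) :
    (G □ H).pathNumber ≤ L.card := by
  refine pathNumber_le_card (G □ H) (Fin.valEmbedding.prodMap (.refl V)) L hL ?_ fun e => ?_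
  · rw [h]
    refine nodup_columns_add_layers hA (fun e he => ?_) (Finset.nodup _) _
    obtain ⟨e', he', rfl⟩ := (hAG e).1 he
    induction e' with | _ a b
    simpa [Fin.ext_iff] using G.ne_of_adj he'
  · rw [h, Multiset.mem_add, Multiset.mem_sum, Multiset.mem_sum]
    constructor
    · rintro (⟨v, -, he⟩ | ⟨i, hi, he⟩)
      · obtain ⟨e₁, he₁, rfl⟩ := Multiset.mem_map.1 he
        obtain ⟨e', he', rfl⟩ := (hAG e₁).1 he₁
        induction e' with | _ a b
        exact ⟨s((a, v), (b, v)), by simpa [boxProd_adj] using he', rfl⟩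
      · obtain ⟨e', he', rfl⟩ := Multiset.mem_map.1 he
        induction e' with | _ a b
        exact ⟨s((⟨i, Finset.mem_range.1 hi⟩, a), (⟨i, Finset.mem_range.1 hi⟩, b)),
          by simpa [boxProd_adj] using he', rfl⟩
    · rintro ⟨e', he', rfl⟩
      induction e' with | _ x y
      obtain ⟨a, v⟩ := x
      obtain ⟨b, w⟩ := y
      rw [mem_edgeSet, boxProd_adj] at he'
      rcases he' with ⟨hab, hvw⟩ | ⟨hvw, hab⟩
      · obtain rfl : v = w := hvw
        exact Or.inl ⟨v, Finset.mem_univ _, Multiset.mem_map.2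
          ⟨s((a : ℕ), (b : ℕ)), (hAG _).2 ⟨s(a, b), hab, rfl⟩, rfl⟩⟩
      · obtain rfl : a = b := hab
        exact Or.inr ⟨a, Finset.mem_range.2 a.2, Multiset.mem_map.2
          ⟨s(v, w), by simpa using hvw, rfl⟩⟩

theorem mem_familyEdges_iff_exists {k : ℕ} (h0 : 0 < k + 5) (h2 : 2 < k + 5) (h4 : 4 < k + 5)
    (e : Sym2 ℕ) :
    e ∈ familyEdges k ↔ ∃ e' ∈ (pathGraph (k + 5) ⊔ fromEdgeSet
      {s((⟨0, h0⟩ : Fin (k + 5)), (⟨2, h2⟩ : Fin (k + 5))),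
        s((⟨2, h2⟩ : Fin (k + 5)), (⟨4, h4⟩ : Fin (k + 5)))}).edgeSet, Sym2.map Fin.val e' = e := by
  constructor
  · intro he
    have hlt : ∀ {a b : ℕ}, a < b → s(a, b) ∈ familyEdges k → b < k + 5 := by
      intro a b hab h
      rw [mem_familyEdges hab] at h
      omega
    induction e with | _ a b
    have hab : a ≠ b := by simpa using not_isDiag_of_mem_familyEdges he
    have : a < k + 5 ∧ b < k + 5 := by
      rcases hab.lt_or_gt with h | h
      · have := hlt h he
        omega
      · have := hlt h (Sym2.eq_swap ▸ he)
        omega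
    exact ⟨s(⟨a, this.1⟩, ⟨b, this.2⟩),
      (adj_familyA_iff ⟨a, this.1⟩ ⟨b, this.2⟩ h2 h4 h0).2 he, rfl⟩
  · rintro ⟨e', he', rfl⟩
    induction e' with | _ a b
    exact (adj_familyA_iff a b h2 h4 h0).1 he'

end Routes

/-- Gallai's bound for the product of a member of the family `𝒜`
(path `u₁⋯u_m` plus edges `u₁u₃` and `u₃u₅`) with a connected graph `H`. -/
theorem pathNumber_familyA_boxProd_le {W : Type*} [Fintype W] (m : ℕ) (hm : 5 ≤ m)
    (H : SimpleGraph W) (hH : H.Connected) :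
    2 * ((pathGraph m ⊔ fromEdgeSet
        {s((⟨0, by omega⟩ : Fin m), (⟨2, by omega⟩ : Fin m)),
         s((⟨2, by omega⟩ : Fin m), (⟨4, by omega⟩ : Fin m))}) □ H).pathNumber ≤
      m * Fintype.card W := by
  classical
  obtain ⟨N, X, hN, hX, hE, hends, hlast⟩ :=
    exists_mainEnd_decomposition H.edgeFinset fun e he =>
      H.not_isDiag_of_mem_edgeSet (mem_edgeFinset.1 he)
  obtain ⟨t, rfl | rfl⟩ : ∃ t, m = 2 * t + 5 ∨ m = 2 * t + 1 + 5 := ⟨(m - 5) / 2, by omega⟩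
  · obtain ⟨L, hL, hs, hc⟩ := exists_routes_of_odd hN hX hE hends hlast t
    have := pathNumber_boxProd_le_card _ (nodup_familyEdges _)
      (mem_familyEdges_iff_exists (by omega) (by omega) (by omega)) H hL hs
    exact (Nat.mul_le_mul_left 2 this).trans hc
  · obtain ⟨L, hL, hs, hc⟩ := exists_routes_of_even hN hX hE hends hlast t
    have := pathNumber_boxProd_le_card _ (nodup_familyEdges _)
      (mem_familyEdges_iff_exists (by omega) (by omega) (by omega)) H hL hs
    exact (Nat.mul_le_mul_left 2 this).trans hc
end

section
/- Let m ≥ 5 be an integer and let G be the graph obtained from the path P_m = u₁u₂⋯u_m by adding the two edges u₁u₄ and u₂u₅. Then for every connected simple graph H of order n, p(G □ H) ≤ mn/2. -/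
open SimpleGraph

namespace PathFamily

variable {V : Type*}

/-- The multiset of edges joining consecutive entries of a list of vertices. -/
def edges : List V → Multiset (Sym2 V)
  | x :: y :: t => s(x, y) ::ₘ edges (y :: t)
  | _ => 0

/-- The first vertex of a list, as a multiset. -/
def first (l : List V) : Multiset V := (l.head?.toList : Multiset V)

/-- The last vertex of a list, as a multiset. -/
def last (l : List V) : Multiset V := (l.getLast?.toList : Multiset V)

/-- The total multiset of edges of a family of lists. -/
def total (F : Multiset (List V)) : Multiset (Sym2 V) := (F.map edges).sum

/-- The multiset of first and last vertices of a family of lists. -/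
def ends (F : Multiset (List V)) : Multiset V := (F.map fun l => first l + last l).sum

@[simp] theorem edges_nil : edges ([] : List V) = 0 := rfl
@[simp] theorem edges_singleton (x : V) : edges [x] = 0 := rfl
@[simp] theorem edges_cons_cons (x y : V) (t : List V) :
    edges (x :: y :: t) = s(x, y) ::ₘ edges (y :: t) := rfl

theorem edges_append_cons (l t : List V) (x : V) :
    edges (l ++ x :: t) = edges (l ++ [x]) + edges (x :: t) := by
  induction l with
  | nil => simp
  | cons y l ih =>
    cases l with
    | nil => simp
    | cons z l => simpa using ih

@[simp] theorem edges_reverse (l : List V) : edges l.reverse = edges l := by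
  induction l with
  | nil => rfl
  | cons x l ih =>
    cases l with
    | nil => rfl
    | cons y l =>
      rw [edges_cons_cons, ← ih]
      simp only [List.reverse_cons, List.append_assoc, List.cons_append, List.nil_append]
      rw [edges_append_cons, edges_cons_cons, edges_singleton, Sym2.eq_swap]
      exact add_comm _ _

theorem edges_append (l l' : List V) (x y : V) (hx : l.getLast? = some x)
    (hy : l'.head? = some y) : edges (l ++ l') = edges l + s(x, y) ::ₘ edges l' := by
  obtain ⟨l, rfl⟩ := List.getLast?_eq_some_iff.1 hx
  obtain ⟨l', rfl⟩ := List.head?_eq_some_iff.1 hy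
  simp only [List.append_assoc, List.cons_append, List.nil_append]
  rw [edges_append_cons, edges_cons_cons]

theorem edges_map {U : Type*} (f : V → U) (l : List V) :
    edges (l.map f) = (edges l).map (Sym2.map f) := by
  induction l with
  | nil => rfl
  | cons x l ih =>
    cases l with
    | nil => rfl
    | cons y l => simpa using ih

theorem mem_of_mem_edges {l : List V} {e : Sym2 V} (he : e ∈ edges l) {v : V} (hv : v ∈ e) :
    v ∈ l := by
  induction l with
  | nil => simp at he
  | cons x l ih =>
    cases l with
    | nil => simp at he
    | cons y l =>
      rcases Multiset.mem_cons.1 he with rfl | he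
      · rcases Sym2.mem_iff.1 hv with rfl | rfl <;> simp
      · exact List.mem_cons_of_mem _ (ih he)

@[simp] theorem first_cons (x : V) (l : List V) : first (x :: l) = {x} := rfl
@[simp] theorem last_append_singleton (x : V) (l : List V) : last (l ++ [x]) = {x} := by
  simp [last]
@[simp] theorem last_singleton (x : V) : last [x] = {x} := rfl
@[simp] theorem last_cons_cons (x y : V) (l : List V) : last (x :: y :: l) = last (y :: l) := by
  simp [last]
@[simp] theorem last_append_cons (x : V) (l t : List V) : last (l ++ x :: t) = last (x :: t) := by
  obtain ⟨u, y, h⟩ : ∃ u y, x :: t = u ++ [y] :=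
    ⟨_, _, (List.dropLast_append_getLast (List.cons_ne_nil x t)).symm⟩
  rw [h, ← List.append_assoc, last_append_singleton, last_append_singleton]
@[simp] theorem first_reverse (l : List V) : first l.reverse = last l := by simp [first, last]
@[simp] theorem last_reverse (l : List V) : last l.reverse = first l := by simp [first, last]

@[simp] theorem total_zero : total (0 : Multiset (List V)) = 0 := rfl
@[simp] theorem total_cons (l : List V) (F : Multiset (List V)) :
    total (l ::ₘ F) = edges l + total F := by simp [total]
@[simp] theorem total_add (F F' : Multiset (List V)) :
    total (F + F') = total F + total F' := by simp [total]
@[simp] theorem ends_zero : ends (0 : Multiset (List V)) = 0 := rfl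
@[simp] theorem ends_cons (l : List V) (F : Multiset (List V)) :
    ends (l ::ₘ F) = first l + last l + ends F := by simp [ends]
@[simp] theorem ends_add (F F' : Multiset (List V)) :
    ends (F + F') = ends F + ends F' := by simp [ends]

theorem mem_total {F : Multiset (List V)} {e : Sym2 V} :
    e ∈ total F ↔ ∃ l ∈ F, e ∈ edges l := by
  induction F using Multiset.induction with
  | empty => simp
  | cons l F ih => simp [ih]

theorem mem_ends {F : Multiset (List V)} {v : V} :
    v ∈ ends F ↔ ∃ l ∈ F, ∃ p, (p = l ∨ p = l.reverse) ∧ p.head? = some v := by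
  induction F using Multiset.induction with
  | empty => simp
  | cons l F ih => simp [ih, first, last, or_and_right, exists_or]

/-- Adding an edge `ab` to a path family by shifting one path end from `b` to `a`: the rotation
along `a` never revisits a vertex of `S`. -/
theorem exists_add_edge_aux [Fintype V] [DecidableEq V] (a : V) (n : ℕ) :
    ∀ (S : Finset V) (b : V) (F : Multiset (List V)), Fintype.card V ≤ S.card + n →
      (∀ l ∈ F, l.Nodup) → (total F).Nodup → s(a, b) ∉ total F → a ≠ b → b ∉ S →
      (∀ v, v ∉ S → (v = b ∨ s(a, v) ∈ total F) → ∃ l ∈ F, ∃ p, (p = l ∨ p = l.reverse) ∧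
        p.head? = some v ∧ ∀ p₁ x p₂, p = p₁ ++ x :: a :: p₂ → x ∉ S) →
      ∃ F' : Multiset (List V), (∀ l ∈ F', l.Nodup) ∧ total F' = s(a, b) ::ₘ total F ∧
        b ::ₘ ends F' = a ::ₘ ends F := by
  induction n with
  | zero =>
    intro S b F hS _ _ _ _ hb
    have := Finset.card_lt_univ_of_notMem hb
    omega
  | succ n ih =>
    intro S b F hS hF hnd hab hne hb hinv
    obtain ⟨l, hl, p, hp, hpb, hpS⟩ := hinv b hb (Or.inl rfl)
    obtain ⟨R, rfl⟩ := Multiset.exists_cons_of_mem hl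
    have hpe : edges p = edges l := by rcases hp with rfl | rfl <;> simp
    have hpends : first p + last p = first l + last l := by
      rcases hp with rfl | rfl <;> simp [add_comm]
    have hpn : p.Nodup := by
      have := hF l hl
      rcases hp with rfl | rfl <;> simpa
    have hR : ∀ l ∈ R, l.Nodup := fun l h => hF l (Multiset.mem_cons_of_mem h)
    rw [total_cons, ← hpe] at hab hnd hinv
    rw [total_cons, ends_cons, ← hpe, ← hpends]
    have hlp : ∀ p', (p' = l ∨ p' = l.reverse) → p' = p ∨ p' = p.reverse := by
      rcases hp with rfl | rfl <;> simp [or_comm]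
    clear hl hp hpe hpends
    obtain ⟨t, rfl⟩ := List.head?_eq_some_iff.1 hpb
    by_cases hap : a ∈ b :: t
    · obtain ⟨q, p₂, hpp⟩ := List.append_of_mem hap
      generalize b :: t = p at *
      subst hpp
      obtain ⟨p₁, x, rfl⟩ : ∃ p₁ x, q = p₁ ++ [x] := by
        rcases List.eq_nil_or_concat q with rfl | ⟨p₁, x, h⟩
        · simp only [List.nil_append, List.head?_cons, Option.some.injEq] at hpb
          exact absurd hpb hne
        · exact ⟨p₁, x, by simpa using h⟩
      have hxS : x ∉ S := hpS p₁ x p₂ (by simp)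
      have hpe : edges (p₁ ++ [x] ++ a :: p₂) =
          edges (p₁ ++ [x]) + s(x, a) ::ₘ edges (a :: p₂) :=
        edges_append _ _ x a (by simp) rfl
      have hxb : x ≠ b := by
        rintro rfl
        apply hab
        rw [hpe, Sym2.eq_swap]
        simp
      have hne_b : ∀ y, s(a, y) ∈ edges (p₁ ++ [x] ++ a :: p₂) + total R → y ≠ b := by
        rintro y h rfl
        exact hab h
      have hperm : ((p₁ ++ [x]).reverse ++ a :: p₂).Perm (p₁ ++ [x] ++ a :: p₂) :=
        List.Perm.append_right _ (List.reverse_perm _)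
      have hne' : edges ((p₁ ++ [x]).reverse ++ a :: p₂) =
          edges (p₁ ++ [x]) + s(a, b) ::ₘ edges (a :: p₂) := by
        rw [edges_append _ (a :: p₂) b a _ rfl, edges_reverse, Sym2.eq_swap]
        rw [List.getLast?_reverse]
        cases p₁ <;> simpa using hpb
      have hswap : s(a, x) ::ₘ (edges ((p₁ ++ [x]).reverse ++ a :: p₂) + total R) =
          s(a, b) ::ₘ (edges (p₁ ++ [x] ++ a :: p₂) + total R) := by
        rw [hne', hpe, Sym2.eq_swap (a := x)]
        simp only [← Multiset.singleton_add]
        abel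
      have hfirst : first (p₁ ++ [x] ++ a :: p₂) = {b} := by
        rw [first, hpb]
        rfl
      have hcons_nd : (s(a, x) ::ₘ (edges ((p₁ ++ [x]).reverse ++ a :: p₂) + total R)).Nodup := by
        rw [hswap]
        exact Multiset.nodup_cons.2 ⟨hab, hnd⟩
      obtain ⟨F', hF', htF', heF'⟩ := ih (insert b S) x
        (((p₁ ++ [x]).reverse ++ a :: p₂) ::ₘ R)
        (by rw [Finset.card_insert_of_notMem hb]; omega)
        (by
          intro l' hl'
          rcases Multiset.mem_cons.1 hl' with rfl | h
          · exact hperm.nodup_iff.2 hpn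
          · exact hR _ h)
        (by rw [total_cons]; exact (Multiset.nodup_cons.1 hcons_nd).2)
        (by rw [total_cons]; exact (Multiset.nodup_cons.1 hcons_nd).1)
        (by
          rintro rfl
          rw [List.nodup_append] at hpn
          exact hpn.2.2 a (by simp) a (by simp) rfl)
        (by simp [hxb, hxS])
        (by
          intro v hvS hv
          rw [Finset.mem_insert, not_or] at hvS
          have hav : s(a, v) ∈ edges (p₁ ++ [x] ++ a :: p₂) + total R := by
            have : s(a, v) ∈ s(a, b) ::ₘ (edges (p₁ ++ [x] ++ a :: p₂) + total R) := by
              rw [← hswap, Multiset.mem_cons]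
              rcases hv with rfl | hv
              · exact Or.inl rfl
              · rw [total_cons] at hv
                exact Or.inr hv
            rcases Multiset.mem_cons.1 this with h | h
            · rw [Sym2.congr_right] at h
              exact absurd h hvS.1
            · exact h
          obtain ⟨l', hl', p', hp', hpv, hpS'⟩ := hinv v hvS.2 (Or.inr hav)
          have hmem : ∀ p₁' y p₂', p' = p₁' ++ y :: a :: p₂' → s(a, y) ∈ edges l' := by
            rintro p₁' y p₂' rfl
            have : s(y, a) ∈ edges (p₁' ++ y :: a :: p₂') := by
              rw [edges_append_cons]
              simp
            rw [Sym2.eq_swap]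
            rcases hp' with h | h
            · rwa [h] at this
            · rwa [h, edges_reverse] at this
          rcases Multiset.mem_cons.1 hl' with rfl | hl'
          · rcases hlp p' hp' with rfl | rfl
            · rw [hpb, Option.some.injEq] at hpv
              exact absurd hpv.symm hvS.1
            · refine ⟨_, Multiset.mem_cons_self _ _, _, Or.inr rfl, ?_, ?_⟩
              · rw [← hpv]
                cases p₂.reverse <;> simp
              · intro u₁ y u₂ hu
                have hu' : p₂.reverse ++ a :: (p₁ ++ [x]) = (u₁ ++ [y]) ++ a :: u₂ := by
                  simpa using hu
                have hnd' : (p₂.reverse ++ a :: (p₁ ++ [x])).Nodup := by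
                  have := List.nodup_reverse.2 (hperm.nodup_iff.2 hpn)
                  simpa using this
                have hpu : p₂.reverse = u₁ ++ [y] := by
                  rw [List.nodup_append] at hnd'
                  refine ((List.append_cons_inj_of_notMem (fun h => ?_) fun h => ?_).1 hu').1
                  · exact hnd'.2.2 a h a (by simp) rfl
                  · exact (List.nodup_cons.1 hnd'.2.1).1 h
                have hpr : (p₁ ++ [x] ++ a :: p₂).reverse = u₁ ++ y :: a :: x :: p₁.reverse := by
                  simp [hpu]
                rw [Finset.mem_insert, not_or]
                refine ⟨hne_b y (Multiset.mem_add.2 (Or.inl ?_)), hpS' _ _ _ hpr⟩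
                rw [← edges_reverse, hpr, edges_append_cons, Sym2.eq_swap]
                simp
          · refine ⟨l', Multiset.mem_cons_of_mem hl', p', hp', hpv, ?_⟩
            intro p₁' y p₂' h
            rw [Finset.mem_insert, not_or]
            refine ⟨hne_b y ?_, hpS' _ _ _ h⟩
            exact Multiset.mem_add.2 (Or.inr (mem_total.2 ⟨l', hl', hmem _ _ _ h⟩)))
      refine ⟨F', hF', by rw [htF', total_cons, hswap], ?_⟩
      have hends : ends (((p₁ ++ [x]).reverse ++ a :: p₂) ::ₘ R) =
          {x} + last (a :: p₂) + ends R := by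
        rw [ends_cons, last_append_cons, List.reverse_append]
        rfl
      rw [← Multiset.cons_inj_right x, Multiset.cons_swap, heF', hfirst, hends, last_append_cons]
      simp only [← Multiset.singleton_add]
      abel
    · refine ⟨(a :: b :: t) ::ₘ R, ?_, by simp, by simp [Multiset.cons_swap]⟩
      intro l' hl'
      rcases Multiset.mem_cons.1 hl' with rfl | h
      · exact List.nodup_cons.2 ⟨hap, hpn⟩
      · exact hR _ h


theorem exists_add_edge [Fintype V] [DecidableEq V] {a b : V} {F : Multiset (List V)}
    (hF : ∀ l ∈ F, l.Nodup) (hnd : (total F).Nodup) (hab : s(a, b) ∉ total F) (hne : a ≠ b)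
    (hb : b ∈ ends F) (ha : ∀ v, s(a, v) ∈ total F → v ∈ ends F) :
    ∃ F' : Multiset (List V), (∀ l ∈ F', l.Nodup) ∧ total F' = s(a, b) ::ₘ total F ∧
      b ::ₘ ends F' = a ::ₘ ends F := by
  refine exists_add_edge_aux a (Fintype.card V) ∅ b F (by simp) hF hnd hab hne (by simp) ?_
  intro v _ hv
  obtain ⟨l, hl, p, hp, hpv⟩ := mem_ends.1 (show v ∈ ends F by
    rcases hv with rfl | hv
    · exact hb
    · exact ha v hv)
  exact ⟨l, hl, p, hp, hpv, by simp⟩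

theorem ends_map_singleton (s : Multiset V) : ends (s.map fun v => [v]) = s + s := by
  induction s using Multiset.induction with
  | empty => rfl
  | cons v s ih =>
    rw [Multiset.map_cons, ends_cons, ih]
    simp only [first_cons, last_singleton, ← Multiset.singleton_add]
    abel

theorem total_map_singleton (s : Multiset V) : total (s.map fun v => [v]) = 0 := by
  induction s using Multiset.induction with
  | empty => rfl
  | cons v s ih => simp [ih]

theorem total_filter_length (F : Multiset (List V)) :
    total (F.filter fun l => 2 ≤ l.length) = total F := by
  induction F using Multiset.induction with
  | empty => rfl
  | cons l F ih =>
    by_cases h : 2 ≤ l.length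
    · simp [h, ih]
    · have : edges l = 0 := by
        rcases l with _ | ⟨x, _ | ⟨y, l⟩⟩
        · rfl
        · rfl
        · simp at h
      simp [h, ih, this]

theorem ends_filter_le (F : Multiset (List V)) (P : List V → Prop) [DecidablePred P] :
    ends (F.filter P) ≤ ends F := by
  conv_rhs => rw [← Multiset.filter_add_not P F, ends_add]
  exact Multiset.le_add_right _ _

theorem even_count_ends_add_degree [DecidableEq V] (v : V) {F : Multiset (List V)}
    (hF : ∀ l ∈ F, l.Nodup) :
    Even ((ends F).count v + ((total F).filter (v ∈ ·)).card) := by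
  have key : ∀ l : List V, l.Nodup →
      Even ((first l + last l).count v + ((edges l).filter (v ∈ ·)).card) := by
    intro l
    induction l with
    | nil => simp [first, last]
    | cons x l ih =>
      cases l with
      | nil =>
        intro _
        rw [first_cons, last_singleton, Multiset.count_add]
        simp
      | cons y l =>
        intro hl
        have ih := ih (List.nodup_cons.1 hl).2
        have hxy : x ≠ y := fun h => (List.nodup_cons.1 hl).1 (by simp [h])
        simp only [first_cons, last_cons_cons, edges_cons_cons, Multiset.count_add,
          Multiset.count_singleton, Multiset.filter_cons, Sym2.mem_iff, Multiset.card_add]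
          at ih ⊢
        rw [Nat.even_iff] at ih ⊢
        by_cases hx : v = x
        · have hy : v ≠ y := hx ▸ hxy
          simp [hx, hxy] at ih ⊢
          omega
        · by_cases hy : v = y
          · simp [hy, hxy.symm] at ih ⊢
            omega
          · simp [hx, hy] at ih ⊢
            omega
  induction F using Multiset.induction with
  | empty => simp
  | cons l F ih =>
    have h₁ := key l (hF l (Multiset.mem_cons_self _ _))
    have h₂ := ih fun l h => hF l (Multiset.mem_cons_of_mem h)
    have := h₁.add h₂
    simp only [ends_cons, total_cons, Multiset.filter_add, Multiset.card_add,
      Multiset.count_add] at this ⊢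
    rwa [add_add_add_comm]

theorem exists_cons_edge [Fintype V] [DecidableEq V] {u v : V} {F : Multiset (List V)}
    (hF : ∀ l ∈ F, l.Nodup) (hnd : (total F).Nodup) (hc : ∀ w, (ends F).count w ≤ 2)
    (hu : (ends F).count u ≤ 1) (huv : u ≠ v) (h : s(u, v) ∉ total F)
    (hdiag : ∀ e ∈ total F, ¬ e.IsDiag) :
    ∃ F' : Multiset (List V), (∀ l ∈ F', l.Nodup ∧ 2 ≤ l.length) ∧
      total F' = s(u, v) ::ₘ total F ∧ (∀ w, (ends F').count w ≤ 2) ∧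
      (ends F').count u ≤ (ends F).count u + 1 ∧ (ends F').count v ≤ 1 ∧
      ((ends F).count v = 1 → (ends F').count v = 0) := by
  set Z : Finset V := Finset.univ.filter fun w => w ∉ ends F ∧ w ≠ u with hZ
  set G : Multiset (List V) := F + Z.val.map fun w => [w] with hG
  have hGt : total G = total F := by rw [hG, total_add, total_map_singleton, add_zero]
  have hGc : ∀ w, (ends G).count w = (ends F).count w + if w ∈ Z then 2 else 0 := by
    intro w
    rw [hG, ends_add, ends_map_singleton, Multiset.count_add, Multiset.count_add]
    split_ifs with hw
    · rw [Multiset.count_eq_one_of_mem Z.nodup hw]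
    · rw [Multiset.count_eq_zero_of_notMem hw]
  have hmem : ∀ w, w ≠ u → w ∈ ends G := by
    intro w hw
    rw [← Multiset.count_pos, hGc]
    by_cases hwF : w ∈ ends F
    · have := Multiset.count_pos.2 hwF
      omega
    · have : w ∈ Z := by simp [hZ, hwF, hw]
      simp [this]
  have hcount : ∀ w, w ∈ Z → (ends F).count w = 0 := by
    intro w hw
    rw [hZ, Finset.mem_filter] at hw
    exact Multiset.count_eq_zero_of_notMem hw.2.1
  have huZ : u ∉ Z := by simp [hZ]
  obtain ⟨F', hF', htF', heF'⟩ := exists_add_edge (a := u) (b := v) (F := G)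
    (by
      intro l hl
      rw [hG, Multiset.mem_add, Multiset.mem_map] at hl
      rcases hl with hl | ⟨w, _, rfl⟩
      · exact hF l hl
      · simp)
    (hGt ▸ hnd) (hGt ▸ h) huv (hmem v huv.symm)
    (by
      intro w hw
      refine hmem w ?_
      rintro rfl
      exact hdiag _ (hGt ▸ hw) (Sym2.mk_isDiag_iff.2 rfl))
  have hle : ∀ w, (ends (F'.filter fun l => 2 ≤ l.length)).count w ≤ (ends F').count w :=
    fun w => Multiset.count_le_of_le w (ends_filter_le _ _)
  have hF'c : ∀ w, (ends F').count w + (if w = v then 1 else 0) =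
      (ends F).count w + (if w ∈ Z then 2 else 0) + if w = u then 1 else 0 := by
    intro w
    have := congrArg (Multiset.count w) heF'
    rwa [Multiset.count_cons, Multiset.count_cons, hGc] at this
  refine ⟨F'.filter fun l => 2 ≤ l.length, ?_, by rw [total_filter_length, htF', hGt], ?_, ?_,
    ?_, ?_⟩
  · intro l hl
    rw [Multiset.mem_filter] at hl
    exact ⟨hF' l hl.1, hl.2⟩
  · intro w
    refine (hle w).trans ?_
    have h₁ := hF'c w
    have h₂ := hc w
    have h₃ := hcount w
    by_cases hwu : w = u
    · subst hwu
      simp [huZ, huv] at h₁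
      omega
    · by_cases hw : w ∈ Z
      · simp [hwu, hw, h₃ hw] at h₁
        split_ifs at h₁ <;> omega
      · simp [hwu, hw] at h₁
        split_ifs at h₁ <;> omega
  · refine (hle u).trans ?_
    have h₁ := hF'c u
    simp [huZ, huv] at h₁
    omega
  · refine (hle v).trans ?_
    have h₁ := hF'c v
    have h₂ := hc v
    have h₃ := hcount v
    by_cases hw : v ∈ Z
    · simp [huv.symm, hw, h₃ hw] at h₁
      omega
    · simp [huv.symm, hw] at h₁
      omega
  · intro hv
    have h₁ := hF'c v
    have h₃ := hcount v
    have hw : v ∉ Z := fun hw => by have := h₃ hw; omega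
    have := hle v
    simp [huv.symm, hw] at h₁
    omega

/-- A strengthening of Lovász's theorem on path decompositions of graphs all of whose degrees are
odd: every finite set of edges splits into paths so that each vertex is an end of at most two of
them, and any prescribed vertex of at most one. -/
theorem exists_paths_ends_le [Fintype V] [DecidableEq V] (n : ℕ) :
    ∀ (E : Finset (Sym2 V)), E.card = n → (∀ e ∈ E, ¬ e.IsDiag) → ∀ a : V,
      ∃ F : Multiset (List V), (∀ l ∈ F, l.Nodup ∧ 2 ≤ l.length) ∧ total F = E.val ∧
        (∀ v, (ends F).count v ≤ 2) ∧ (ends F).count a ≤ 1 := by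
  induction n with
  | zero =>
    intro E hE _ a
    rw [Finset.card_eq_zero] at hE
    subst hE
    exact ⟨0, by simp, rfl, by simp, by simp⟩
  | succ n ih =>
    intro E hE hdiag
    have main : ∀ a b, s(a, b) ∈ E → ∃ F : Multiset (List V),
        (∀ l ∈ F, l.Nodup ∧ 2 ≤ l.length) ∧ total F = E.val ∧
        (∀ v, (ends F).count v ≤ 2) ∧ (ends F).count a ≤ 1 := by
      intro a b hab
      have hne : a ≠ b := fun h => hdiag _ hab h
      have hcard : (E.erase s(a, b)).card = n := by rw [Finset.card_erase_of_mem hab]; omega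
      have hd : ∀ e ∈ E.erase s(a, b), ¬e.IsDiag := fun e he => hdiag e (Finset.mem_of_mem_erase he)
      have hval : s(a, b) ::ₘ (E.erase s(a, b)).val = E.val := by
        rw [Finset.erase_val]
        exact Multiset.cons_erase hab
      have hpar : ∀ F : Multiset (List V), (∀ l ∈ F, l.Nodup ∧ 2 ≤ l.length) →
          total F = (E.erase s(a, b)).val →
          Even ((ends F).count a + (((E.erase s(a, b)).val).filter (a ∈ ·)).card) := by
        intro F hF ht
        rw [← ht]
        exact even_count_ends_add_degree a fun l hl => (hF l hl).1
      by_cases hdeg : Even (((E.erase s(a, b)).val.filter (a ∈ ·)).card)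
      · obtain ⟨F, hF, ht, hc, ha⟩ := ih _ hcard hd a
        have h₁ := hpar F hF ht
        rw [Nat.even_add] at h₁
        have h₂ : (ends F).count a = 0 := by
          have := h₁.2 hdeg
          rw [Nat.even_iff] at this
          omega
        obtain ⟨F', hF', ht', hc', hu', -⟩ := exists_cons_edge (fun l hl => (hF l hl).1)
          (ht ▸ Finset.nodup _) hc ha hne (by rw [ht]; exact Finset.notMem_erase _ _)
          (by rw [ht]; exact hd)
        exact ⟨F', hF', by rw [ht', ht, hval], hc', by omega⟩
      · obtain ⟨F, hF, ht, hc, hb⟩ := ih _ hcard hd b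
        have h₁ := hpar F hF ht
        rw [Nat.even_add] at h₁
        have h₂ : (ends F).count a = 1 := by
          have h₃ := mt h₁.1 hdeg
          have := hc a
          rw [Nat.even_iff] at h₃
          omega
        rw [Sym2.eq_swap] at ht hval hd
        obtain ⟨F', hF', ht', hc', -, -, hv'⟩ := exists_cons_edge (fun l hl => (hF l hl).1)
          (ht ▸ Finset.nodup _) hc hb hne.symm
          (by rw [ht]; exact Finset.notMem_erase _ _)
          (by rw [ht]; exact hd)
        exact ⟨F', hF', by rw [ht', ht, hval], hc', by rw [hv' h₂]; omega⟩
    intro a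
    by_cases ha : ∃ b, s(a, b) ∈ E
    · obtain ⟨b, hab⟩ := ha
      exact main a b hab
    · obtain ⟨e, he⟩ : E.Nonempty := by
        rw [← Finset.card_pos]
        omega
      induction e using Sym2.ind with
      | _ c d =>
        obtain ⟨F, hF, ht, hc, -⟩ := main c d he
        refine ⟨F, hF, ht, hc, ?_⟩
        rw [Multiset.count_eq_zero_of_notMem]
        · omega
        · intro haF
          obtain ⟨l, hl, p, hp, hpa⟩ := mem_ends.1 haF
          obtain ⟨t, rfl⟩ := List.head?_eq_some_iff.1 hpa
          have hlen := (hF l hl).2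
          have hedge : edges (a :: t) = edges l := by rcases hp with h | h <;> simp [h]
          have hlen' : (a :: t).length = l.length := by rcases hp with h | h <;> simp [h]
          rcases t with _ | ⟨b, t⟩
          · simp at hlen'
            omega
          · refine ha ⟨b, ?_⟩
            rw [← Finset.mem_val, ← ht]
            refine mem_total.2 ⟨l, hl, ?_⟩
            rw [← hedge]
            simp

/-- The multiset of first vertices of a family of lists. -/
def starts (F : Multiset (List V)) : Multiset V := (F.map first).sum

/-- The multiset of last vertices of a family of lists. -/
def finishes (F : Multiset (List V)) : Multiset V := (F.map last).sum

@[simp] theorem starts_zero : starts (0 : Multiset (List V)) = 0 := rfl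
@[simp] theorem starts_cons (l : List V) (F : Multiset (List V)) :
    starts (l ::ₘ F) = first l + starts F := by simp [starts]
@[simp] theorem finishes_zero : finishes (0 : Multiset (List V)) = 0 := rfl
@[simp] theorem finishes_cons (l : List V) (F : Multiset (List V)) :
    finishes (l ::ₘ F) = last l + finishes F := by simp [finishes]

theorem ends_eq_starts_add_finishes (F : Multiset (List V)) : ends F = starts F + finishes F :=
  Multiset.sum_map_add

theorem ends_eq_of_rel {F F' : Multiset (List V)}
    (h : Multiset.Rel (fun p q => q = p ∨ q = p.reverse) F F') : ends F' = ends F := by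
  induction h with
  | zero => rfl
  | cons hpq _ ih => rcases hpq with rfl | rfl <;> simp [ih, add_comm]

theorem total_eq_of_rel {F F' : Multiset (List V)}
    (h : Multiset.Rel (fun p q => q = p ∨ q = p.reverse) F F') : total F' = total F := by
  induction h with
  | zero => rfl
  | cons hpq _ ih => rcases hpq with rfl | rfl <;> simp [ih]

theorem exists_orientation [DecidableEq V] (n : ℕ) :
    ∀ F : Multiset (List V), F.card = n → (∀ l ∈ F, l ≠ []) → (∀ v, (ends F).count v ≤ 2) →
      ∃ F', Multiset.Rel (fun p q => q = p ∨ q = p.reverse) F F' ∧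
        (starts F').Nodup ∧ (finishes F').Nodup := by
  induction n with
  | zero =>
    intro F hF _ _
    rw [Multiset.card_eq_zero] at hF
    subst hF
    exact ⟨0, Multiset.Rel.zero, by simp, by simp⟩
  | succ n ih =>
    intro F hF hne hc
    obtain ⟨p, hpF⟩ := Multiset.card_pos_iff_exists_mem.1 (by omega : 0 < F.card)
    obtain ⟨R, rfl⟩ := Multiset.exists_cons_of_mem hpF
    have hR : R.card = n := by simpa using hF
    have hp : p ≠ [] := hne p (Multiset.mem_cons_self _ _)
    have hneR : ∀ l ∈ R, l ≠ [] := fun l hl => hne l (Multiset.mem_cons_of_mem hl)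
    obtain ⟨x, hx⟩ : ∃ x, first p = {x} :=
      ⟨p.head hp, by rw [first, List.head?_eq_some_head hp]; rfl⟩
    obtain ⟨w, hw⟩ : ∃ w, last p = {w} :=
      ⟨p.getLast hp, by rw [last, List.getLast?_eq_some_getLast hp]; rfl⟩
    simp only [ends_cons, hx, hw, Multiset.count_add, Multiset.count_singleton] at hc
    by_cases hwR : w ∈ ends R
    · obtain ⟨q, hq, q', hq', hqw⟩ := mem_ends.1 hwR
      obtain ⟨R, rfl⟩ := Multiset.exists_cons_of_mem hq
      obtain ⟨t, rfl⟩ := List.head?_eq_some_iff.1 hqw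
      have hqends : first q + last q = {w} + last (w :: t) := by
        rcases hq' with h | h
        · rw [← h]
          rfl
        · rw [← first_reverse, ← last_reverse, ← h, add_comm]
          rfl
      have hfirst : first (p ++ w :: t) = {x} := by
        rw [← hx]
        cases p with
        | nil => exact absurd rfl hp
        | cons y p => rfl
      have hlast : last (p ++ w :: t) = last (w :: t) := last_append_cons _ _ _
      simp only [ends_cons, hqends, Multiset.count_add, Multiset.count_singleton] at hc
      obtain ⟨F', hrel, hs, hf⟩ := ih ((p ++ w :: t) ::ₘ R) (by simpa using hR)
        (by
          intro l hl
          rcases Multiset.mem_cons.1 hl with rfl | hl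
          · simp
          · exact hneR l (Multiset.mem_cons_of_mem hl))
        (by
          intro v
          have := hc v
          simp only [ends_cons, hfirst, hlast, Multiset.count_add, Multiset.count_singleton]
          omega)
      obtain ⟨z, R', hz, hrel', rfl⟩ := Multiset.rel_cons_left.1 hrel
      rw [← ends_eq_of_rel hrel', ends_eq_starts_add_finishes] at hc
      simp only [Multiset.count_add] at hc
      simp only [Multiset.nodup_iff_count_le_one] at hs hf ⊢
      rcases hz with rfl | rfl
      · refine ⟨p ::ₘ (w :: t) ::ₘ R', .cons (Or.inl rfl) (.cons ?_ hrel'),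
          fun v => ?_, fun v => ?_⟩
        · rcases hq' with h | h
          · exact Or.inl h
          · exact Or.inr h
        · have h₁ := hc v
          have h₂ := hs v
          simp only [starts_cons, hx, hfirst, first_cons, Multiset.count_add,
            Multiset.count_singleton] at h₂ ⊢
          split_ifs at * <;> omega
        · have h₁ := hc v
          have h₂ := hf v
          simp only [finishes_cons, hw, hlast, Multiset.count_add,
            Multiset.count_singleton] at h₂ ⊢
          split_ifs at * <;> omega
      · refine ⟨p.reverse ::ₘ (w :: t).reverse ::ₘ R', .cons (Or.inr rfl) (.cons ?_ hrel'),
          fun v => ?_, fun v => ?_⟩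
        · rcases hq' with h | h
          · exact Or.inr (by rw [h])
          · exact Or.inl (by rw [h, List.reverse_reverse])
        · have h₁ := hc v
          have h₂ := hs v
          simp only [starts_cons, hw, hlast, first_reverse, Multiset.count_add,
            Multiset.count_singleton] at h₂ ⊢
          split_ifs at * <;> omega
        · have h₁ := hc v
          have h₂ := hf v
          simp only [finishes_cons, hx, hfirst, last_reverse, first_cons, Multiset.count_add,
            Multiset.count_singleton] at h₂ ⊢
          split_ifs at * <;> omega
    · obtain ⟨R', hrel, hs, hf⟩ := ih R hR hneR fun v => by
        have := hc v
        omega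
      rw [← ends_eq_of_rel hrel, ends_eq_starts_add_finishes] at hc hwR
      rw [Multiset.mem_add, not_or] at hwR
      simp only [Multiset.count_add] at hc
      by_cases hxs : x ∈ starts R'
      · refine ⟨p.reverse ::ₘ R', .cons (Or.inr rfl) hrel, ?_, ?_⟩
        · rw [starts_cons, first_reverse, hw]
          exact Multiset.nodup_cons.2 ⟨hwR.1, hs⟩
        · rw [finishes_cons, last_reverse, hx]
          refine Multiset.nodup_cons.2 ⟨fun h => ?_, hf⟩
          have h₁ := hc x
          have h₂ := Multiset.count_pos.2 h
          have h₃ := Multiset.count_pos.2 hxs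
          have h₄ : x ≠ w := fun h => hwR.1 (h ▸ hxs)
          simp only [if_true] at h₁
          omega
      · refine ⟨p ::ₘ R', .cons (Or.inl rfl) hrel, ?_, ?_⟩
        · rw [starts_cons, hx]
          exact Multiset.nodup_cons.2 ⟨hxs, hs⟩
        · rw [finishes_cons, hw]
          exact Multiset.nodup_cons.2 ⟨hwR.2, hf⟩

/-- `M` is the edge multiset of a family of at most `k` nonempty repetition-free lists of
elements of `S`. -/
def IsPathSum (S : Set V) (M : Multiset (Sym2 V)) (k : ℕ) : Prop :=
  ∃ F : Multiset (List V), F.card ≤ k ∧ (∀ l ∈ F, l ≠ [] ∧ l.Nodup ∧ ∀ v ∈ l, v ∈ S) ∧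
    total F = M

theorem isPathSum_zero (S : Set V) : IsPathSum S 0 0 := ⟨0, by simp, by simp, by simp⟩

theorem isPathSum_edges {S : Set V} {l : List V} (hne : l ≠ []) (hl : l.Nodup)
    (hS : ∀ v ∈ l, v ∈ S) : IsPathSum S (edges l) 1 :=
  ⟨{l}, by simp, by simpa using ⟨hne, hl, hS⟩, by simp [total]⟩

theorem IsPathSum.add {S : Set V} {M M' : Multiset (Sym2 V)} {k k' : ℕ} (h : IsPathSum S M k)
    (h' : IsPathSum S M' k') : IsPathSum S (M + M') (k + k') := by
  obtain ⟨F, hF, hl, rfl⟩ := h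
  obtain ⟨F', hF', hl', rfl⟩ := h'
  refine ⟨F + F', by rw [Multiset.card_add]; omega, fun l hm => ?_, total_add F F'⟩
  exact (Multiset.mem_add.1 hm).elim (hl l) (hl' l)

theorem IsPathSum.sum {ι : Type*} {S : Set V} (s : Finset ι) {f : ι → Multiset (Sym2 V)}
    {k : ι → ℕ} (h : ∀ i ∈ s, IsPathSum S (f i) (k i)) :
    IsPathSum S (∑ i ∈ s, f i) (∑ i ∈ s, k i) := by
  classical
  induction s using Finset.induction_on with
  | empty => exact isPathSum_zero S
  | insert a s ha ih =>
    rw [Finset.sum_insert ha, Finset.sum_insert ha]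
    exact (h a (Finset.mem_insert_self a s)).add
      (ih fun i hi => h i (Finset.mem_insert_of_mem hi))

theorem IsPathSum.map {U : Type*} {S : Set V} {T : Set U} {M : Multiset (Sym2 V)} {k : ℕ}
    (h : IsPathSum S M k) {f : V → U} (hf : S.InjOn f) (hT : S.MapsTo f T) :
    IsPathSum T (M.map (Sym2.map f)) k := by
  obtain ⟨F, hF, hl, rfl⟩ := h
  refine ⟨F.map (List.map f), by simpa using hF, fun l hm => ?_, ?_⟩
  · obtain ⟨p, hp, rfl⟩ := Multiset.mem_map.1 hm
    obtain ⟨hne, hnd, hS⟩ := hl p hp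
    refine ⟨by simpa using hne, hnd.map_on fun x hx y hy => hf (hS x hx) (hS y hy),
      fun v hv => ?_⟩
    obtain ⟨u, hu, rfl⟩ := List.mem_map.1 hv
    exact hT (hS u hu)
  · clear hF hl
    induction F using Multiset.induction_on with
    | empty => rfl
    | cons l F ih => simp [ih, edges_map]

/-- The multiset of edges of the parallel class `b` among the `n` consecutive edges
starting at `k`. -/
def links : Bool → ℕ → ℕ → Multiset (Sym2 ℕ)
  | _, _, 0 => 0
  | b, k, n + 1 => (if b then {s(k, k + 1)} else 0) + links (!b) (k + 1) n

@[simp] theorem links_zero (b : Bool) (k : ℕ) : links b k 0 = 0 := rfl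
@[simp] theorem links_true_succ (k n : ℕ) :
    links true k (n + 1) = s(k, k + 1) ::ₘ links false (k + 1) n := by
  simp [links]
@[simp] theorem links_false_succ (k n : ℕ) :
    links false k (n + 1) = links true (k + 1) n := by
  simp [links]

theorem card_links (k n : ℕ) : (links true k n).card + (links false k n).card = n := by
  induction n generalizing k with
  | zero => rfl
  | succ n ih =>
    have := ih (k + 1)
    simp only [links_true_succ, links_false_succ, Multiset.card_cons]
    omega

theorem mem_links {b : Bool} {k n : ℕ} {e : Sym2 ℕ} (h : e ∈ links b k n) :
    ∃ i, k ≤ i ∧ i < k + n ∧ e = s(i, i + 1) := by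
  induction n generalizing b k with
  | zero => simp at h
  | succ n ih =>
    have hrec : ∀ b, e ∈ links b (k + 1) n → ∃ i, k ≤ i ∧ i < k + (n + 1) ∧ e = s(i, i + 1) := by
      intro b h
      obtain ⟨i, h₁, h₂, h₃⟩ := ih h
      exact ⟨i, by omega, by omega, h₃⟩
    cases b with
    | false => exact hrec _ (by simpa using h)
    | true =>
      rw [links_true_succ] at h
      rcases Multiset.mem_cons.1 h with h | h
      · exact ⟨k, le_rfl, by omega, h⟩
      · exact hrec _ h

theorem edges_range' (k n : ℕ) :
    edges (List.range' k (n + 1)) = links true k n + links false k n := by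
  induction n generalizing k with
  | zero => rfl
  | succ n ih =>
    rw [List.range'_succ, List.range'_succ, edges_cons_cons, ← List.range'_succ, ih]
    simp [add_comm]

variable {W : Type*}

/-- The copy of a list of vertices in the layer `i`. -/
def copy (i : ℕ) (l : List W) : List (ℕ × W) := l.map (Prod.mk i)

/-- The copy of a multiset of edges in the layer `i`. -/
def lay (i : ℕ) (M : Multiset (Sym2 W)) : Multiset (Sym2 (ℕ × W)) :=
  M.map (Sym2.map (Prod.mk i))

/-- The copy of a multiset of edges in the fibre over `w`. -/
def fib (w : W) (M : Multiset (Sym2 ℕ)) : Multiset (Sym2 (ℕ × W)) :=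
  M.map (Sym2.map (·, w))

@[simp] theorem lay_zero (i : ℕ) : lay i (0 : Multiset (Sym2 W)) = 0 := rfl
@[simp] theorem lay_add (i : ℕ) (M M' : Multiset (Sym2 W)) :
    lay i (M + M') = lay i M + lay i M' := Multiset.map_add _ _ _
@[simp] theorem fib_zero (w : W) : fib w 0 = 0 := rfl
@[simp] theorem fib_add (w : W) (M M' : Multiset (Sym2 ℕ)) :
    fib w (M + M') = fib w M + fib w M' := Multiset.map_add _ _ _
@[simp] theorem fib_cons (w : W) (i j : ℕ) (M : Multiset (Sym2 ℕ)) :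
    fib w (s(i, j) ::ₘ M) = s((i, w), (j, w)) ::ₘ fib w M := Multiset.map_cons _ _ _

theorem edges_copy (i : ℕ) (l : List W) : edges (copy i l) = lay i (edges l) := edges_map _ _

theorem head?_copy {i : ℕ} {l : List W} {x : W} (h : l.head? = some x) :
    (copy i l).head? = some (i, x) := by simp [copy, h]

theorem getLast?_copy {i : ℕ} {l : List W} {x : W} (h : l.getLast? = some x) :
    (copy i l).getLast? = some (i, x) := by simp [copy, h]

@[simp] theorem mem_copy {i : ℕ} {l : List W} {v : ℕ × W} :
    v ∈ copy i l ↔ v.1 = i ∧ v.2 ∈ l := by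
  rcases v with ⟨j, w⟩
  simp only [copy, List.mem_map, Prod.mk.injEq]
  constructor
  · rintro ⟨a, ha, rfl, rfl⟩
    exact ⟨rfl, ha⟩
  · rintro ⟨rfl, hw⟩
    exact ⟨w, hw, rfl, rfl⟩

theorem nodup_copy (i : ℕ) {l : List W} (h : l.Nodup) : (copy i l).Nodup :=
  h.map (Prod.mk_right_injective i)

/-- The list traversing the copies of `l` in the layers `k, …, k + n` alternately forwards and
backwards. -/
def snake (l : List W) (k : ℕ) : ℕ → List (ℕ × W)
  | 0 => copy k l
  | n + 1 => copy k l ++ snake l.reverse (k + 1) n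

theorem mem_snake {l : List W} {k n : ℕ} {v : ℕ × W} :
    v ∈ snake l k n → k ≤ v.1 ∧ v.1 ≤ k + n ∧ v.2 ∈ l := by
  induction n generalizing l k with
  | zero =>
    intro h
    obtain ⟨h, h'⟩ := mem_copy.1 h
    exact ⟨h.ge, h.le, h'⟩
  | succ n ih =>
    intro h
    rcases List.mem_append.1 h with h | h
    · obtain ⟨h, h'⟩ := mem_copy.1 h
      exact ⟨h.ge, by omega, h'⟩
    · obtain ⟨h₁, h₂, h₃⟩ := ih h
      exact ⟨by omega, by omega, List.mem_reverse.1 h₃⟩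

theorem nodup_snake {l : List W} (hl : l.Nodup) (k n : ℕ) : (snake l k n).Nodup := by
  induction n generalizing l k with
  | zero => exact nodup_copy k hl
  | succ n ih =>
    refine (nodup_copy k hl).append (ih (List.nodup_reverse.2 hl) (k + 1)) fun v h h' => ?_
    have h₁ := (mem_copy.1 h).1
    have h₂ := (mem_snake h').1
    omega

theorem head?_snake {l : List W} {x : W} (hx : l.head? = some x) (k n : ℕ) :
    (snake l k n).head? = some (k, x) := by
  cases n with
  | zero => exact head?_copy hx
  | succ n => simp [snake, List.head?_append, head?_copy hx]

theorem edges_snake {l : List W} {x y : W} (hx : l.head? = some x) (hy : l.getLast? = some y)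
    (k n : ℕ) : edges (snake l k n) =
      ∑ i ∈ Finset.range (n + 1), lay (k + i) (edges l) + fib y (links true k n) +
        fib x (links false k n) := by
  induction n generalizing l k x y with
  | zero => simp [snake, edges_copy]
  | succ n ih =>
    have hx' : l.reverse.getLast? = some x := by rw [List.getLast?_reverse, hx]
    have hy' : l.reverse.head? = some y := by rw [List.head?_reverse, hy]
    rw [snake, edges_append _ _ _ _ (getLast?_copy hy) (head?_snake hy' _ _), ih hy' hx',
      Finset.sum_range_succ' _ (n + 1), edges_reverse, edges_copy]
    simp only [links_true_succ, links_false_succ, fib_cons, add_zero, ← add_assoc k,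
      add_right_comm k 1, ← Multiset.singleton_add (s(_, _) : Sym2 (ℕ × W))]
    abel

/-- The edges of the first factor used in the fibres over first vertices of paths. -/
def startEdges (n : ℕ) : Multiset (Sym2 ℕ) := s(0, 1) ::ₘ s(2, 3) ::ₘ links true 4 n

/-- The edges of the first factor used in the fibres over last vertices of paths. -/
def finishEdges (n : ℕ) : Multiset (Sym2 ℕ) :=
  s(3, 0) ::ₘ s(1, 4) ::ₘ s(1, 2) ::ₘ s(3, 4) ::ₘ links false 4 n

theorem isPathSum_layers {l : List W} {x y : W} (hl : l.Nodup) (hx : l.head? = some x)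
    (hy : l.getLast? = some y) (n : ℕ) :
    IsPathSum {v : ℕ × W | v.1 < n + 5}
      (∑ i ∈ Finset.range (n + 5), lay i (edges l) + fib x (startEdges n) +
        fib y (finishEdges n)) 2 := by
  have hx' : l.reverse.getLast? = some x := by rw [List.getLast?_reverse, hx]
  have hy' : l.reverse.head? = some y := by rw [List.head?_reverse, hy]
  have hl' : l.reverse.Nodup := List.nodup_reverse.2 hl
  have h₁ : IsPathSum {v : ℕ × W | v.1 < n + 5}
      (edges ([(3, y)] ++ (copy 0 l.reverse ++ (copy 1 l ++ snake l.reverse 4 n)))) 1 := by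
    refine isPathSum_edges (by simp) ?_ fun v hv => ?_
    · refine List.Nodup.append (List.nodup_singleton _) (List.Nodup.append (nodup_copy _ hl')
        (List.Nodup.append (nodup_copy _ hl) (nodup_snake hl' _ _) ?_) ?_) ?_
      all_goals
        intro v hv hv'
        simp only [List.mem_append, mem_copy, List.mem_singleton] at hv hv'
        have := @mem_snake _ l.reverse 4 n v
        grind
    · simp only [List.mem_append, mem_copy, List.mem_singleton] at hv
      have := @mem_snake _ l.reverse 4 n v
      simp only [Set.mem_ofPred_eq]
      grind
  have h₂ : IsPathSum {v : ℕ × W | v.1 < n + 5}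
      (edges ([(1, y)] ++ (copy 2 l.reverse ++ (copy 3 l ++ [(4, y)])))) 1 := by
    refine isPathSum_edges (by simp) ?_ fun v hv => ?_
    · refine List.Nodup.append (List.nodup_singleton _) (List.Nodup.append (nodup_copy _ hl')
        (List.Nodup.append (nodup_copy _ hl) (List.nodup_singleton _) ?_) ?_) ?_
      all_goals
        intro v hv hv'
        simp only [List.mem_append, mem_copy, List.mem_singleton] at hv hv'
        grind
    · simp only [List.mem_append, mem_copy, List.mem_singleton] at hv
      simp only [Set.mem_ofPred_eq]
      grind
  convert h₁.add h₂ using 1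
  rw [edges_append _ _ (3, y) (0, y) rfl (by simp [List.head?_append, head?_copy hy']),
    edges_append _ _ (0, x) (1, x) (getLast?_copy hx')
      (by simp [List.head?_append, head?_copy hx]),
    edges_append _ _ (1, y) (4, y) (getLast?_copy hy) (head?_snake hy' _ _),
    edges_snake hy' hx',
    edges_append _ _ (1, y) (2, y) rfl (by simp [List.head?_append, head?_copy hy']),
    edges_append _ _ (2, x) (3, x) (getLast?_copy hx')
      (by simp [List.head?_append, head?_copy hx]),
    edges_append _ _ (3, y) (4, y) (getLast?_copy hy) rfl,
    show n + 5 = 4 + (n + 1) by omega, Finset.sum_range_add _ 4 (n + 1)]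
  simp only [startEdges, finishEdges, Finset.sum_range_succ _ 3, Finset.sum_range_succ _ 2,
    Finset.sum_range_succ _ 1, Finset.sum_range_succ _ 0, Finset.sum_range_zero, edges_singleton,
    edges_copy, edges_reverse, fib_cons, ← Multiset.singleton_add (s(_, _) : Sym2 (ℕ × W))]
  abel

theorem isPathSum_family {F : Multiset (List W)} (hF : ∀ l ∈ F, l ≠ [] ∧ l.Nodup) (n : ℕ) :
    IsPathSum {v : ℕ × W | v.1 < n + 5}
      (∑ i ∈ Finset.range (n + 5), lay i (total F) +
        ((starts F).map fun w => fib w (startEdges n)).sum +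
        ((finishes F).map fun w => fib w (finishEdges n)).sum) (2 * F.card) := by
  induction F using Multiset.induction_on with
  | empty => simpa using isPathSum_zero _
  | cons l F ih =>
    obtain ⟨hne, hl⟩ := hF l (Multiset.mem_cons_self _ _)
    have hx := List.head?_eq_some_head hne
    have hy := List.getLast?_eq_some_getLast hne
    convert (isPathSum_layers hl hx hy n).add
      (ih fun p hp => hF p (Multiset.mem_cons_of_mem hp)) using 1
    · simp only [total_cons, starts_cons, finishes_cons, first, last, hx, hy, lay_add,
        Finset.sum_add_distrib, Multiset.map_add, Multiset.sum_add, Option.toList_some,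
        Multiset.coe_singleton, Multiset.map_singleton, Multiset.sum_singleton]
      abel
    · rw [Multiset.card_cons]
      ring

theorem isPathSum_fib {S : Set ℕ} {M : Multiset (Sym2 ℕ)} {k : ℕ} (h : IsPathSum S M k)
    (w : W) : IsPathSum {v : ℕ × W | v.1 ∈ S} (fib w M) k :=
  h.map (Prod.mk_left_injective w).injOn fun _ hi => hi

theorem isPathSum_links (b : Bool) (n : ℕ) :
    IsPathSum {i | i < n + 5} (links b 4 n) (links b 4 n).card := by
  refine ⟨(links b 4 n).map fun e => [e.inf, e.sup], by simp, fun l hl => ?_, ?_⟩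
  · obtain ⟨e, he, rfl⟩ := Multiset.mem_map.1 hl
    obtain ⟨i, h₁, h₂, rfl⟩ := mem_links he
    simp
    omega
  · rw [total, Multiset.map_map]
    have : ∀ e ∈ links b 4 n, (edges ∘ fun e : Sym2 ℕ => [e.inf, e.sup]) e = {e} := by
      intro e he
      obtain ⟨i, h₁, h₂, rfl⟩ := mem_links he
      simp
    rw [Multiset.map_congr rfl this, Multiset.sum_map_singleton]

theorem isPathSum_startEdges (n : ℕ) :
    IsPathSum {i | i < n + 5} (startEdges n) (2 + (links true 4 n).card) := by
  have h₁ : IsPathSum {i | i < n + 5} (edges [0, 1]) 1 :=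
    isPathSum_edges (by simp) (by simp) (by simp)
  have h₂ : IsPathSum {i | i < n + 5} (edges [2, 3]) 1 :=
    isPathSum_edges (by simp) (by simp) (by simp)
  convert (h₁.add h₂).add (isPathSum_links true n) using 1
  simp only [startEdges, edges_cons_cons, edges_singleton,
    ← Multiset.singleton_add (s(_, _) : Sym2 ℕ)]
  abel

theorem isPathSum_finishEdges (n : ℕ) :
    IsPathSum {i | i < n + 5} (finishEdges n) (1 + (links false 4 n).card) := by
  have h : IsPathSum {i | i < n + 5} (edges [2, 1, 4, 3, 0]) 1 :=
    isPathSum_edges (by simp) (by simp) (by simp)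
  convert h.add (isPathSum_links false n) using 1
  simp only [finishEdges, edges_cons_cons, edges_singleton, @Sym2.eq_swap _ 2 1,
    @Sym2.eq_swap _ 4 3, ← Multiset.singleton_add (s(_, _) : Sym2 ℕ)]
  abel

theorem isPathSum_startEdges_add_finishEdges (n : ℕ) :
    IsPathSum {i | i < n + 5} (startEdges n + finishEdges n) 2 := by
  have h₁ : IsPathSum {i | i < n + 5} (edges ([1, 0, 3] ++ List.range' 4 (n + 1))) 1 := by
    refine isPathSum_edges (by simp) ?_ fun i hi => ?_
    · refine List.Nodup.append (by simp) List.nodup_range' fun i hi hi' => ?_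
      simp at hi hi'
      omega
    · simp at hi ⊢
      omega
  have h₂ : IsPathSum {i | i < n + 5} (edges [4, 1, 2, 3]) 1 :=
    isPathSum_edges (by simp) (by simp) (by simp)
  convert h₁.add h₂ using 1
  rw [edges_append _ _ 3 4 rfl rfl, edges_range']
  simp only [startEdges, finishEdges, edges_cons_cons, edges_singleton, @Sym2.eq_swap _ 1 0,
    @Sym2.eq_swap _ 0 3, @Sym2.eq_swap _ 4 1, ← Multiset.singleton_add (s(_, _) : Sym2 ℕ)]
  abel

theorem exists_isPathSum [Fintype W] [DecidableEq W] [Nonempty W] {E : Finset (Sym2 W)}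
    (hE : ∀ e ∈ E, ¬e.IsDiag) (n : ℕ) :
    ∃ k, 2 * k ≤ (n + 5) * Fintype.card W ∧ IsPathSum {v : ℕ × W | v.1 < n + 5}
      (∑ i ∈ Finset.range (n + 5), lay i E.val +
        ∑ w : W, fib w (startEdges n + finishEdges n)) k := by
  obtain ⟨F, hF, htot, hends, -⟩ := exists_paths_ends_le _ E rfl hE (Classical.arbitrary W)
  obtain ⟨F', hrel, hs, hf⟩ := exists_orientation _ F rfl
    (fun l hl => by have := (hF l hl).2; rintro rfl; simp at this) hends
  have hF' : ∀ l ∈ F', l ≠ [] ∧ l.Nodup := by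
    intro l hl
    obtain ⟨p, hp, h⟩ := Multiset.exists_mem_of_rel_of_mem (Multiset.rel_flip.2 hrel) hl
    obtain ⟨h₁, h₂⟩ := hF p hp
    have hp0 : p ≠ [] := by rintro rfl; simp at h₂
    rcases h with rfl | rfl
    · exact ⟨hp0, h₁⟩
    · exact ⟨by simpa using hp0, List.nodup_reverse.2 h₁⟩
  have hcs : (starts F').card = F'.card := by
    clear hs hf hrel
    induction F' using Multiset.induction_on with
    | empty => rfl
    | cons l F ih =>
      rw [starts_cons, Multiset.card_add, ih fun p hp => hF' p (Multiset.mem_cons_of_mem hp),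
        first, List.head?_eq_some_head (hF' l (Multiset.mem_cons_self _ _)).1]
      simp [add_comm]
  have hcf : (finishes F').card = F'.card := by
    clear hs hf hrel hcs
    induction F' using Multiset.induction_on with
    | empty => rfl
    | cons l F ih =>
      rw [finishes_cons, Multiset.card_add, ih fun p hp => hF' p (Multiset.mem_cons_of_mem hp),
        last, List.getLast?_eq_some_getLast (hF' l (Multiset.mem_cons_self _ _)).1]
      simp [add_comm]
  have hmain := isPathSum_family hF' n
  rw [total_eq_of_rel hrel, htot] at hmain
  set A : Finset W := ⟨starts F', hs⟩ with hA
  set B : Finset W := ⟨finishes F', hf⟩ with hB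
  have hcA : A.card = F'.card := hcs
  have hcB : B.card = F'.card := hcf
  change IsPathSum _ (_ + ∑ w ∈ A, fib w (startEdges n) + ∑ w ∈ B, fib w (finishEdges n)) _
    at hmain
  clear_value A B
  have hrest := IsPathSum.sum (S := {v : ℕ × W | v.1 < n + 5}) Finset.univ
    (f := fun w => if w ∈ A then if w ∈ B then 0 else fib w (finishEdges n)
      else if w ∈ B then fib w (startEdges n) else fib w (startEdges n + finishEdges n))
    (k := fun w => if w ∈ A then if w ∈ B then 0 else 1 + (links false 4 n).card
      else if w ∈ B then 2 + (links true 4 n).card else 2) fun w _ => by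
        split_ifs
        · exact isPathSum_zero _
        · exact isPathSum_fib (isPathSum_finishEdges n) w
        · exact isPathSum_fib (isPathSum_startEdges n) w
        · exact isPathSum_fib (isPathSum_startEdges_add_finishEdges n) w
  refine ⟨_, ?_, (congrArg (IsPathSum _ · _) ?_).mp (hmain.add hrest)⟩
  rotate_left
  · rw [← Finset.univ_inter A, ← Finset.univ_inter B, ← Finset.sum_ite_mem, ← Finset.sum_ite_mem,
      add_assoc, add_assoc, ← Finset.sum_add_distrib, ← Finset.sum_add_distrib,
      Finset.univ_inter, Finset.univ_inter]
    congr 1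
    refine Finset.sum_congr rfl fun w _ => ?_
    split_ifs <;> simp [add_comm]
  · have hlinks := card_links 4 n
    set x := (links true 4 n).card
    set y := (links false 4 n).card
    have hA' : (F'.card : ℤ) = ∑ w : W, if w ∈ A then 1 else 0 := by simp [hcA]
    have hB' : (F'.card : ℤ) = ∑ w : W, if w ∈ B then 1 else 0 := by simp [hcB]
    have hsum : ∑ w : W, (((n : ℤ) + 3 - 2 * y) * (if w ∈ A then 1 else 0) +
        (1 - n + 2 * y) * (if w ∈ B then 1 else 0) +
        2 * ((if w ∈ A then if w ∈ B then 0 else 1 + y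
          else if w ∈ B then 2 + x else 2 : ℕ) : ℤ)) ≤ ∑ _w : W, ((n : ℤ) + 5) := by
      refine Finset.sum_le_sum fun w _ => ?_
      split_ifs <;> push_cast <;> omega
    rw [Finset.sum_add_distrib, Finset.sum_add_distrib, ← Finset.mul_sum, ← Finset.mul_sum,
      ← Finset.mul_sum, ← hA', ← hB', Finset.sum_const, Finset.card_univ, nsmul_eq_mul,
      ← Nat.cast_sum] at hsum
    zify
    push_cast at hsum ⊢
    linarith

theorem mem_lay {i : ℕ} {M : Multiset (Sym2 W)} {p q : ℕ × W} :
    s(p, q) ∈ lay i M ↔ p.1 = i ∧ q.1 = i ∧ s(p.2, q.2) ∈ M := by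
  constructor
  · intro h
    obtain ⟨e, he, h⟩ := Multiset.mem_map.1 h
    induction e with | _ a b
    rw [Sym2.map_mk, Sym2.eq_iff] at h
    rcases h with ⟨rfl, rfl⟩ | ⟨rfl, rfl⟩
    · exact ⟨rfl, rfl, he⟩
    · exact ⟨rfl, rfl, Sym2.eq_swap ▸ he⟩
  · rintro ⟨hp, rfl, h⟩
    exact Multiset.mem_map.2 ⟨_, h, by rw [Sym2.map_mk, ← hp, Prod.mk.eta, hp]⟩

theorem mem_fib {w : W} {M : Multiset (Sym2 ℕ)} {p q : ℕ × W} :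
    s(p, q) ∈ fib w M ↔ p.2 = w ∧ q.2 = w ∧ s(p.1, q.1) ∈ M := by
  constructor
  · intro h
    obtain ⟨e, he, h⟩ := Multiset.mem_map.1 h
    induction e with | _ a b
    rw [Sym2.map_mk, Sym2.eq_iff] at h
    rcases h with ⟨rfl, rfl⟩ | ⟨rfl, rfl⟩
    · exact ⟨rfl, rfl, he⟩
    · exact ⟨rfl, rfl, Sym2.eq_swap ▸ he⟩
  · rintro ⟨hp, rfl, h⟩
    exact Multiset.mem_map.2 ⟨_, h, by rw [Sym2.map_mk, ← hp, Prod.mk.eta, hp]⟩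

theorem nodup_sum {ι α : Type*} (s : Finset ι) {f : ι → Multiset α}
    (h : ∀ i ∈ s, (f i).Nodup) (hd : ∀ i ∈ s, ∀ j ∈ s, ∀ a ∈ f i, a ∈ f j → i = j) :
    (∑ i ∈ s, f i).Nodup := by
  classical
  induction s using Finset.induction_on with
  | empty => simp
  | insert a s ha ih =>
    rw [Finset.sum_insert ha, Multiset.nodup_add]
    refine ⟨h a (Finset.mem_insert_self a s), ih (fun i hi => h i (Finset.mem_insert_of_mem hi))
      fun i hi j hj => hd i (Finset.mem_insert_of_mem hi) j (Finset.mem_insert_of_mem hj),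
      Multiset.disjoint_left.2 fun {x} hx hx' => ?_⟩
    obtain ⟨i, hi, hxi⟩ := Multiset.mem_sum.1 hx'
    exact ha (hd a (Finset.mem_insert_self a s) i (Finset.mem_insert_of_mem hi) x hx hxi ▸ hi)

theorem mem_edges_range' {k n i j : ℕ} : s(i, j) ∈ edges (List.range' k (n + 1)) ↔
    k ≤ i ∧ k ≤ j ∧ i ≤ k + n ∧ j ≤ k + n ∧ (i + 1 = j ∨ j + 1 = i) := by
  induction n generalizing k with
  | zero =>
    simp only [zero_add, List.range'_one, edges_singleton, Multiset.notMem_zero, false_iff]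
    omega
  | succ n ih =>
    rw [List.range'_succ, List.range'_succ, edges_cons_cons, ← List.range'_succ,
      Multiset.mem_cons, ih, Sym2.eq_iff]
    omega

theorem nodup_edges_range' (k n : ℕ) : (edges (List.range' k (n + 1))).Nodup := by
  induction n generalizing k with
  | zero => simp
  | succ n ih =>
    rw [List.range'_succ, List.range'_succ, edges_cons_cons, ← List.range'_succ,
      Multiset.nodup_cons, mem_edges_range']
    exact ⟨by omega, ih (k + 1)⟩

theorem startEdges_add_finishEdges (n : ℕ) : startEdges n + finishEdges n =
    s(0, 3) ::ₘ s(1, 4) ::ₘ edges (List.range' 0 (n + 5)) := by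
  have h : List.range' 0 (n + 5) = [0, 1, 2, 3] ++ List.range' 4 (n + 1) := by
    simp [List.range'_succ]
  rw [h, edges_append _ _ 3 4 rfl rfl, edges_range']
  simp only [startEdges, finishEdges, edges_cons_cons, edges_singleton, @Sym2.eq_swap _ 0 3,
    ← Multiset.singleton_add (s(_, _) : Sym2 ℕ)]
  abel

theorem mem_startEdges_add_finishEdges {n i j : ℕ} :
    s(i, j) ∈ startEdges n + finishEdges n ↔ i < n + 5 ∧ j < n + 5 ∧
      (i + 1 = j ∨ j + 1 = i ∨ s(i, j) = s(0, 3) ∨ s(i, j) = s(1, 4)) := by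
  rw [startEdges_add_finishEdges, Multiset.mem_cons, Multiset.mem_cons, mem_edges_range',
    Sym2.eq_iff, Sym2.eq_iff]
  omega

theorem nodup_startEdges_add_finishEdges (n : ℕ) : (startEdges n + finishEdges n).Nodup := by
  rw [startEdges_add_finishEdges, Multiset.nodup_cons, Multiset.nodup_cons, Multiset.mem_cons,
    mem_edges_range', mem_edges_range', Sym2.eq_iff]
  exact ⟨by omega, by omega, nodup_edges_range' 0 (n + 4)⟩

/-- The edges of the product with all layers equal to `E` and all fibres equal to `startEdges n +
finishEdges n`. -/
def prodEdges [Fintype W] (E : Multiset (Sym2 W)) (n : ℕ) : Multiset (Sym2 (ℕ × W)) :=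
  ∑ i ∈ Finset.range (n + 5), lay i E + ∑ w : W, fib w (startEdges n + finishEdges n)

theorem mem_prodEdges [Fintype W] {E : Multiset (Sym2 W)} {n : ℕ} {p q : ℕ × W} :
    s(p, q) ∈ prodEdges E n ↔ (p.1 < n + 5 ∧ p.1 = q.1 ∧ s(p.2, q.2) ∈ E) ∨
      (p.2 = q.2 ∧ s(p.1, q.1) ∈ startEdges n + finishEdges n) := by
  rw [prodEdges, Multiset.mem_add, Multiset.mem_sum, Multiset.mem_sum]
  simp only [mem_lay, mem_fib, Finset.mem_range, Finset.mem_univ, true_and]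
  grind

theorem nodup_prodEdges [Fintype W] {E : Multiset (Sym2 W)} (hE : E.Nodup) (n : ℕ) :
    (prodEdges E n).Nodup := by
  refine Multiset.nodup_add.2 ⟨nodup_sum _ (fun i _ => ?_) ?_, nodup_sum _ (fun w _ => ?_) ?_, ?_⟩
  · exact hE.map (Sym2.map.injective (Prod.mk_right_injective i))
  · intro i _ j _ e h h'
    induction e with | _ p q
    exact (mem_lay.1 h).1.symm.trans (mem_lay.1 h').1
  · exact (nodup_startEdges_add_finishEdges n).map
      (Sym2.map.injective (Prod.mk_left_injective w))
  · intro w _ w' _ e h h'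
    induction e with | _ p q
    exact (mem_fib.1 h).1.symm.trans (mem_fib.1 h').1
  · refine Multiset.disjoint_left.2 fun {e} h h' => ?_
    induction e with | _ p q
    obtain ⟨i, _, h⟩ := Multiset.mem_sum.1 h
    obtain ⟨w, _, h'⟩ := Multiset.mem_sum.1 h'
    obtain ⟨h₁, h₂, -⟩ := mem_lay.1 h
    have h₃ := (mem_startEdges_add_finishEdges.1 (mem_fib.1 h').2.2).2.2
    rw [Sym2.eq_iff, Sym2.eq_iff] at h₃
    omega

theorem isChain_of_edges {G : SimpleGraph V} {l : List V} (h : ∀ e ∈ edges l, e ∈ G.edgeSet) :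
    l.IsChain G.Adj := by
  induction l with
  | nil => exact .nil
  | cons x l ih =>
    cases l with
    | nil => exact .singleton x
    | cons y l =>
      exact .cons_cons (h _ (Multiset.mem_cons_self _ _))
        (ih fun e he => h e (Multiset.mem_cons_of_mem he))

theorem edges_support {G : SimpleGraph V} {u v : V} (p : G.Walk u v) :
    edges p.support = p.edges := by
  induction p with
  | nil => rfl
  | cons h p ih =>
    rw [Walk.support_cons, Walk.edges_cons, ← Multiset.cons_coe, ← ih]
    cases p <;> rfl

theorem exists_walks {G : SimpleGraph V} (L : List (List V)) (hne : ∀ l ∈ L, l ≠ [])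
    (h : ∀ l ∈ L, ∀ e ∈ edges l, e ∈ G.edgeSet) :
    ∃ P : List (Σ u v : V, G.Walk u v), P.map (fun p => p.2.2.support) = L := by
  induction L with
  | nil => exact ⟨[], rfl⟩
  | cons l L ih =>
    obtain ⟨P, rfl⟩ := ih (fun p hp => hne p (List.mem_cons_of_mem _ hp))
      fun p hp => h p (List.mem_cons_of_mem _ hp)
    have hc := isChain_of_edges (h l List.mem_cons_self)
    exact ⟨⟨_, _, Walk.ofSupport l (hne l List.mem_cons_self) hc⟩ :: P, by
      rw [List.map_cons, Walk.support_ofSupport]⟩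

theorem pairwise_disjoint_of_nodup_sum {ι α : Type*} {f : ι → List α} {L : List ι}
    (h : (L.map fun i => (f i : Multiset α)).sum.Nodup) :
    L.Pairwise fun i j => ∀ a ∈ f i, a ∉ f j := by
  induction L with
  | nil => exact .nil
  | cons i L ih =>
    rw [List.map_cons, List.sum_cons, Multiset.nodup_add] at h
    refine .cons (fun j hj a ha ha' => ?_) (ih h.2.1)
    refine Multiset.disjoint_left.1 h.2.2 (Multiset.mem_coe.2 ha) ?_
    exact Multiset.mem_of_le (List.single_le_sum (fun _ _ => Multiset.zero_le _) _
      (List.mem_map_of_mem hj)) (Multiset.mem_coe.2 ha')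

theorem pathNumber_le_of_isPathSum {G : SimpleGraph V} {M : Multiset (Sym2 V)} {k : ℕ}
    (h : IsPathSum Set.univ M k) (hM : M.Nodup) (hG : ∀ e, e ∈ M ↔ e ∈ G.edgeSet) :
    G.pathNumber ≤ k := by
  obtain ⟨F, hF, hl, rfl⟩ := h
  obtain ⟨L, rfl⟩ : ∃ L : List (List V), F = L := ⟨F.toList, F.coe_toList.symm⟩
  rw [Multiset.coe_card] at hF
  simp only [Multiset.mem_coe] at hl
  obtain ⟨P, rfl⟩ := exists_walks (G := G) L (fun l hm => (hl l hm).1) fun l hm e he =>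
    (hG e).1 (mem_total.2 ⟨l, hm, he⟩)
  have htot : (P.map fun p => (p.2.2.edges : Multiset (Sym2 V))).sum.Nodup := by
    convert hM using 1
    simp [total, Function.comp_def, edges_support]
  rw [List.length_map] at hF
  refine le_trans (Nat.sInf_le ⟨P, ⟨fun p hp => ?_, pairwise_disjoint_of_nodup_sum htot,
    fun e he => ?_⟩, rfl⟩) hF
  · exact (Walk.isPath_def _).2 (hl _ (List.mem_map_of_mem hp)).2.1
  · obtain ⟨l, hm, hel⟩ := mem_total.1 ((hG e).2 he)
    obtain ⟨p, hp, rfl⟩ := List.mem_map.1 (show l ∈ P.map _ from hm)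
    exact ⟨p, hp, by rwa [edges_support] at hel⟩

theorem IsPathSum.mem {S : Set V} {M : Multiset (Sym2 V)} {k : ℕ} (h : IsPathSum S M k)
    {e : Sym2 V} (he : e ∈ M) {v : V} (hv : v ∈ e) : v ∈ S := by
  obtain ⟨F, -, hl, rfl⟩ := h
  obtain ⟨l, hm, hel⟩ := mem_total.1 he
  exact (hl l hm).2.2 v (mem_of_mem_edges hel hv)

end PathFamily

/-- Gallai's bound for the product of a member of the family `ℬ`
(path `u₁⋯u_m` plus edges `u₁u₄` and `u₂u₅`) with a connected graph `H`. -/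
theorem pathNumber_familyB_boxProd_le {W : Type*} [Fintype W] (m : ℕ) (hm : 5 ≤ m)
    (H : SimpleGraph W) (hH : H.Connected) :
    2 * ((pathGraph m ⊔ fromEdgeSet
        {s((⟨0, by omega⟩ : Fin m), (⟨3, by omega⟩ : Fin m)),
         s((⟨1, by omega⟩ : Fin m), (⟨4, by omega⟩ : Fin m))}) □ H).pathNumber ≤
      m * Fintype.card W := by
  classical
  have := hH.nonempty
  obtain ⟨n, rfl⟩ := Nat.exists_eq_add_of_le' hm
  obtain ⟨k, hk, hM⟩ := PathFamily.exists_isPathSum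
    (fun e he => H.not_isDiag_of_mem_edgeSet (mem_edgeFinset.1 he)) n
  change PathFamily.IsPathSum _ (PathFamily.prodEdges H.edgeFinset.val n) k at hM
  have hnd := PathFamily.nodup_prodEdges H.edgeFinset.nodup n
  let φ : ℕ × W → Fin (n + 5) × W := Prod.map (Fin.ofNat (n + 5)) id
  let ψ : Fin (n + 5) × W → ℕ × W := Prod.map Fin.val id
  have hφψ : φ ∘ ψ = id := by
    funext v
    simp [φ, ψ, Prod.map]
  have hψφ : ∀ v ∈ {v : ℕ × W | v.1 < n + 5}, ψ (φ v) = v := by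
    rintro ⟨i, w⟩ hi
    simpa [φ, ψ] using Nat.mod_eq_of_lt hi
  have hinv : ∀ e ∈ PathFamily.prodEdges H.edgeFinset.val n, (e.map φ).map ψ = e := by
    intro e he
    rw [Sym2.map_map]
    exact (Sym2.map_congr fun v hv => hψφ v (hM.mem he hv)).trans (congrFun Sym2.map_id' e)
  refine (Nat.mul_le_mul_left 2 (PathFamily.pathNumber_le_of_isPathSum
    (hM.map (f := φ) (fun v hv w hw h => by rw [← hψφ v hv, h, hψφ w hw])
      fun _ _ => Set.mem_univ _) ?_ fun e => ?_)).trans hk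
  · exact hnd.map_on fun e he e' he' h => by rw [← hinv e he, h, hinv e' he']
  · have hmem : e ∈ (PathFamily.prodEdges H.edgeFinset.val n).map (Sym2.map φ) ↔
        e.map ψ ∈ PathFamily.prodEdges H.edgeFinset.val n := by
      refine ⟨fun h => ?_, fun h => Multiset.mem_map.2 ⟨_, h, ?_⟩⟩
      · obtain ⟨e, he, rfl⟩ := Multiset.mem_map.1 h
        rwa [hinv e he]
      · rw [Sym2.map_map, hφψ, Sym2.map_id, id]
    rw [hmem]
    induction e with | _ p q
    obtain ⟨⟨i, hi⟩, v⟩ := p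
    obtain ⟨⟨j, hj⟩, w⟩ := q
    rw [Sym2.map_mk, PathFamily.mem_prodEdges, PathFamily.mem_startEdges_add_finishEdges]
    simp only [ψ, Prod.map, id, mem_edgeSet, boxProd_adj, sup_adj, fromEdgeSet_adj, pathGraph_adj,
      Finset.mem_val, mem_edgeFinset, Sym2.eq_iff, Set.mem_insert_iff, Set.mem_singleton_iff,
      Fin.mk.injEq, ne_eq]
    grind
end
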